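/- arXiv:2005.03757 — 2 statements merged into one kernel-verified Lean document; each statement's English description precedes it below -/
import Mathlib

section
/- Let G be a finite group with vcs(G) = {s}, let π = π(s), and suppose G = NH where N is a nilpotent normal Hall π-subgroup of G and H is an abelian π-complement of G, and G/Z(G) is a Frobenius group with kernel NZ(G)/Z(G) of order s and complement HZ(G)/Z(G), with N containing no vanishing elements of G. Then G = C_N(H) × M, where C_N(H) ≤ Z(G), M = [N,H]H is the normal closure of H in G, and M/C_H(N) is a Frobenius group whose Frobenius kernel [N,H]C_H(N)/C_H(N) contains no vanishing element of M/C_H(N). Furthermore, the unique vanishing class size s of G equals |[N,H]|. -/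
open scoped Classical

noncomputable section

/-- `g` is a vanishing element of `G`: some irreducible complex character of `G`
takes the value `0` at `g`. -/
def IsVanishing (G : Type) [Group G] (g : G) : Prop :=
  ∃ V : FDRep ℂ G, CategoryTheory.Simple V ∧ V.character g = 0

/-- The conjugacy class size of `g`, i.e. `|G : C_G(g)|`. -/
def classSize {G : Type*} [Group G] (g : G) : ℕ := (Subgroup.centralizer {g}).index

/-- The set of conjugacy class sizes of vanishing elements of `G`. -/
def vcs (G : Type) [Group G] : Set ℕ :=
  {n | ∃ g : G, IsVanishing G g ∧ classSize g = n}

/-- The set of conjugacy class sizes of `G`. -/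
def cs (G : Type*) [Group G] : Set ℕ := {n | ∃ g : G, classSize g = n}

/-- `H` is a Hall `π`-subgroup of `G`. -/
def IsHallSubgroup {G : Type*} [Group G] (π : Set ℕ) (H : Subgroup G) : Prop :=
  (∀ p : ℕ, p.Prime → p ∣ Nat.card H → p ∈ π) ∧
  (∀ p : ℕ, p.Prime → p ∣ H.index → p ∉ π)

/-- The set of prime divisors of `n`. -/
def primesOf (n : ℕ) : Set ℕ := {p | p.Prime ∧ p ∣ n}

/-- The `π`-part `n_π` of `n`: the largest divisor of `n` all of whose prime
factors lie in `π`. -/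
noncomputable def piPart (π : Set ℕ) (n : ℕ) : ℕ :=
  ∏ p ∈ n.primeFactors, p ^ (if p ∈ π then n.factorization p else 0)

/-- The subgroup `H` is abelian. -/
def IsAbelianSubgroup {G : Type*} [Group G] (H : Subgroup G) : Prop :=
  ∀ a ∈ H, ∀ b ∈ H, a * b = b * a

/-- `X` is a Frobenius group with kernel `K`: `K` is a nontrivial proper normal
subgroup and the centralizer of every nontrivial element of `K` lies in `K`. -/
def IsFrobeniusWithKernel {X : Type*} [Group X] (K : Subgroup X) : Prop :=
  K ≠ ⊥ ∧ K ≠ ⊤ ∧ K.Normal ∧ ∀ k ∈ K, k ≠ 1 → Subgroup.centralizer {k} ≤ K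

/-- `X` is a Frobenius group with kernel `K` and complement `C`. -/
def IsFrobenius {X : Type*} [Group X] (K C : Subgroup X) : Prop :=
  IsFrobeniusWithKernel K ∧ K ⊔ C = ⊤ ∧ K ⊓ C = ⊥

/-- `G` is supersolvable: there is a chain of subgroups from `⊥` to `⊤`, each
normal in `G`, with all successive quotients cyclic (equivalently, each term is
generated by the previous one together with a single element). -/
def IsSupersolvable (G : Type*) [Group G] : Prop :=
  ∃ (n : ℕ) (c : Fin (n + 1) → Subgroup G),
    c 0 = ⊥ ∧ c (Fin.last n) = ⊤ ∧
    (∀ i : Fin n, c i.castSucc ≤ c i.succ) ∧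
    (∀ i : Fin (n + 1), (c i).Normal) ∧
    (∀ i : Fin n, ∃ g : G, c i.castSucc ⊔ Subgroup.zpowers g = c i.succ)

/-- The Fitting subgroup of `G`: the subgroup generated by all nilpotent normal
subgroups of `G`. -/
def Fitting (G : Type*) [Group G] : Subgroup G :=
  ⨆ H ∈ {H : Subgroup G | H.Normal ∧ Group.IsNilpotent ↥H}, H

/-- `O_p(G)`: the subgroup generated by all normal `p`-subgroups of `G`
(the largest normal `p`-subgroup). -/
def pCore' (p : ℕ) (G : Type*) [Group G] : Subgroup G :=
  ⨆ K ∈ {K : Subgroup G | K.Normal ∧ IsPGroup p ↥K}, K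

/-- Over an algebraically closed field of characteristic zero, an irreducible representation of a
finite group is simple as an object of `FDRep`. -/
theorem FDRep.simple_of_isIrreducible {k G V : Type} [Field k] [IsAlgClosed k] [CharZero k]
    [Group G] [Finite G] [AddCommGroup V] [Module k V] [FiniteDimensional k V]
    (ρ : Representation k G V) [ρ.IsIrreducible] : CategoryTheory.Simple (FDRep.of ρ) := by
  have := Fintype.ofFinite G
  rw [FDRep.simple_iff_char_is_norm_one]
  have h0 : (Nat.card G : k) ≠ 0 := Nat.cast_ne_zero.mpr Nat.card_pos.ne'
  have := invertibleOfNonzero h0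
  have h := Representation.char_orthonormal ρ ρ
  rw [if_pos ⟨Representation.Equiv.refl ρ⟩, inv_mul_eq_one₀ h0] at h
  exact h.symm

open scoped MonoidAlgebra in
/-- A nontrivial central element acts nontrivially in some irreducible representation. -/
theorem exists_irreducible_apply_ne_one {k G : Type} [Field k] [CharZero k] [Group G] [Finite G]
    {z : G} (hz : z ∈ Subgroup.center G) (hz1 : z ≠ 1) :
    ∃ (V : Type) (_ : AddCommGroup V) (_ : Module k V) (_ : FiniteDimensional k V)
      (ρ : Representation k G V), ρ.IsIrreducible ∧ ρ z ≠ 1 := by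
  have : NeZero (Nat.card G : k) := ⟨Nat.cast_ne_zero.mpr Nat.card_pos.ne'⟩
  by_contra! H
  let ζ : k[G] := MonoidAlgebra.single z 1
  have hζ : ∀ a : k[G], ζ * a = a * ζ := by
    intro a
    induction a using MonoidAlgebra.induction_on with
    | of g => simp [ζ, MonoidAlgebra.single_mul_single, (Subgroup.mem_center_iff.mp hz g).symm]
    | add a b ha hb => rw [mul_add, add_mul, ha, hb]
    | smul r a ha => rw [mul_smul_comm, smul_mul_assoc, ha]
  let T : Submodule k[G] k[G] := LinearMap.ker (LinearMap.toSpanSingleton k[G] k[G] (ζ - 1))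
  have hT : T = ⊤ := by
    rw [eq_top_iff, ← IsSemisimpleModule.sSup_simples_eq_top k[G] k[G]]
    refine sSup_le fun S hS v hv ↦ ?_
    have : IsSimpleModule k[G] S := hS
    have : FiniteDimensional k S :=
      FiniteDimensional.finiteDimensional_submodule (S.restrictScalars k)
    let ρ : Representation k G S := Representation.ofModule' S
    let e : S ≃ₗ[k[G]] ρ.asModule :=
      { ρ.asModuleEquiv.symm.toAddEquiv with
        map_smul' := fun r v ↦ by
          have h : ρ.asAlgebraHom = Algebra.lsmul k k S :=
            (MonoidAlgebra.lift k _ G).apply_symm_apply _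
          exact (LinearMap.congr_fun (DFunLike.congr_fun h r) v).symm }
    have hirr : ρ.IsIrreducible :=
      (Representation.irreducible_iff_isSimpleModule_asModule ρ).mpr (IsSimpleModule.congr e.symm)
    have h1 := LinearMap.congr_fun (H _ _ _ this ρ hirr) ⟨v, hv⟩
    have h2 : ζ * v = v := congrArg Subtype.val h1
    change v * (ζ - 1) = 0
    rw [← sub_eq_zero.mpr h2, mul_sub, hζ, mul_one]
  have h1 : (1 : k[G]) ∈ T := hT ▸ Submodule.mem_top
  have h2 : (1 : k[G]) * (ζ - 1) = 0 := h1
  rw [one_mul, sub_eq_zero, MonoidAlgebra.one_def] at h2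
  exact hz1 (MonoidAlgebra.of_injective (R := k) h2)

open scoped commutatorElement in
/-- An element having a nontrivial central commutator is vanishing. -/
theorem isVanishing_of_commutator_mem_center {G : Type} [Group G] [Finite G] {x y : G}
    (hz : ⁅x, y⁆ ∈ Subgroup.center G) (hz1 : ⁅x, y⁆ ≠ 1) : IsVanishing G x := by
  obtain ⟨V, _, _, _, ρ, hρ, hne⟩ := exists_irreducible_apply_ne_one (k := ℂ) hz hz1
  refine ⟨FDRep.of ρ, FDRep.simple_of_isIrreducible ρ, ?_⟩
  change LinearMap.trace ℂ V (ρ x) = 0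
  let f : ρ.IntertwiningMap ρ := ⟨ρ ⁅x, y⁆, fun g ↦ by
    rw [← Module.End.mul_eq_comp, ← Module.End.mul_eq_comp, ← map_mul, ← map_mul,
      Subgroup.mem_center_iff.mp hz g]⟩
  obtain ⟨c, hc⟩ :=
    (Representation.IsIrreducible.algebraMap_intertwiningMap_bijective_of_isAlgClosed
      (ρ := ρ)).2 f
  have hc' : ρ ⁅x, y⁆ = c • 1 := by
    ext v
    exact (congrArg (fun F : ρ.IntertwiningMap ρ ↦ F v) hc).symm
  have hx : ⁅x, y⁆ * (y * x * y⁻¹) = x := by rw [commutatorElement_def]; group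
  have h1 : LinearMap.trace ℂ V (ρ x) = c * LinearMap.trace ℂ V (ρ x) := by
    conv_lhs => rw [← hx, map_mul, hc', smul_mul_assoc, one_mul, map_smul, smul_eq_mul]
    congr 1
    rw [map_mul, LinearMap.trace_mul_comm, ← map_mul, inv_mul_cancel_left]
  have hc1 : c ≠ 1 := fun h ↦ hne (by rw [hc', h, one_smul])
  have h2 : (1 - c) * LinearMap.trace ℂ V (ρ x) = 0 := by rw [sub_mul, one_mul, ← h1, sub_self]
  exact (mul_eq_zero.mp h2).resolve_left (sub_ne_zero.mpr hc1.symm)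

theorem IsVanishing.of_surjective {G Q : Type} [Group G] [Finite G] [Group Q] (f : G →* Q)
    (hf : Function.Surjective f) {x : G} (hx : IsVanishing Q (f x)) : IsVanishing G x := by
  have : Finite Q := Finite.of_surjective f hf
  have := Fintype.ofFinite G
  have := Fintype.ofFinite Q
  obtain ⟨V, hV, hVx⟩ := hx
  have hchar : ∀ g, (FDRep.of (V.ρ.comp f)).character g = V.character (f g) := fun g ↦ rfl
  refine ⟨FDRep.of (V.ρ.comp f), ?_, hVx⟩
  rw [FDRep.simple_iff_char_is_norm_one] at hV ⊢
  simp only [hchar, map_inv]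
  have hfib (q : Q) : (Finset.univ.filter fun g ↦ f g = q).card
      = (Finset.univ.filter fun g ↦ f g = 1).card :=
    MonoidHom.card_fiber_eq_of_mem_range f (hf q) (hf 1)
  have hsum (F : Q → ℂ) : ∑ g, F (f g) = (Finset.univ.filter fun g ↦ f g = 1).card * ∑ q, F q := by
    rw [← Finset.sum_fiberwise (s := Finset.univ) (g := f), Finset.mul_sum]
    refine Finset.sum_congr rfl fun q _ ↦ ?_
    rw [Finset.sum_congr rfl fun g hg ↦ congrArg F (Finset.mem_filter.mp hg).2, Finset.sum_const,
      hfib, nsmul_eq_mul]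
  have hcard := hsum fun _ ↦ 1
  simp only [Finset.sum_const, Finset.card_univ, nsmul_eq_mul, mul_one] at hcard
  rw [hsum fun q ↦ V.character q * V.character q⁻¹, hV, Nat.card_eq_fintype_card,
    Nat.card_eq_fintype_card, hcard]

open scoped commutatorElement

/-- A commutator of a nonvanishing element which is central modulo `K` lies in `K`. -/
theorem commutator_mem_of_not_isVanishing {G : Type} [Group G] [Finite G] (K : Subgroup G)
    [K.Normal] {x y : G} (hx : ¬ IsVanishing G x) (h : ∀ g, ⁅⁅x, y⁆, g⁆ ∈ K) : ⁅x, y⁆ ∈ K := by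
  by_contra hK
  refine hx (IsVanishing.of_surjective (QuotientGroup.mk' K) (QuotientGroup.mk'_surjective K) ?_)
  refine isVanishing_of_commutator_mem_center (y := QuotientGroup.mk' K y) ?_ ?_
  · rw [← map_commutatorElement, Subgroup.mem_center_iff]
    intro q
    obtain ⟨g, rfl⟩ := QuotientGroup.mk'_surjective K q
    have := h g
    rw [← QuotientGroup.eq_one_iff, ← QuotientGroup.mk'_apply, map_commutatorElement,
      commutatorElement_eq_one_iff_mul_comm] at this
    exact this.symm
  · rwa [← map_commutatorElement, QuotientGroup.mk'_apply, Ne, QuotientGroup.eq_one_iff]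

open scoped IsMulCommutative in
/-- The kernel of the norm map `a ↦ ∏ h ∈ H, h * a * h⁻¹` on an abelian normal subgroup `A` on
which the group acts through `H`. -/
theorem Subgroup.exists_norm_kernel {Q : Type*} [Group Q] (A H : Subgroup Q) [A.Normal] [Finite H]
    [IsMulCommutative A]
    (hQ : ∀ q, ∃ n ∈ Subgroup.centralizer (A : Set Q), ∃ h ∈ H, q = n * h) :
    ∃ K ≤ A, K.Normal ∧ (∀ a ∈ A, ∀ h ∈ H, ⁅a, h⁆ ∈ K) ∧
      ∀ k ∈ K, k ∈ Subgroup.center Q → k ^ Nat.card H = 1 := by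
  have := Fintype.ofFinite H
  let c : H → A →* A := fun h ↦ (MulAut.conjNormal (h : Q)).toMonoidHom
  let ν : A →* A := ∏ h : H, c h
  have hν (a : A) : ν a = ∏ h : H, c h a := MonoidHom.finsetProd_apply _ _ _
  have hνc (h : H) (a : A) : ν (c h a) = ν a := by
    rw [hν, hν]
    refine Fintype.prod_equiv (Equiv.mulRight h) _ _ fun k ↦ ?_
    ext
    simp [c, mul_assoc]
  refine ⟨ν.ker.map A.subtype, Subgroup.map_subtype_le _, ⟨?_⟩, ?_, ?_⟩
  · rintro _ ⟨a, ha, rfl⟩ q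
    obtain ⟨n, hn, h, hh, rfl⟩ := hQ q
    refine ⟨c ⟨h, hh⟩ a, (hνc ⟨h, hh⟩ a).trans ha, ?_⟩
    have := Subgroup.mem_centralizer_iff.mp hn _ (c ⟨h, hh⟩ a).2
    simp only [c, MulEquiv.toMonoidHom_eq_coe, MonoidHom.coe_coe, MulAut.conjNormal_apply,
      Subgroup.coe_subtype] at this ⊢
    rw [mul_inv_rev, ← mul_assoc, eq_mul_inv_iff_mul_eq, this]
    group
  · intro a ha h hh
    refine ⟨⟨a, ha⟩ * (c ⟨h, hh⟩ ⟨a, ha⟩)⁻¹, ?_, ?_⟩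
    · change ν _ = 1
      rw [map_mul, map_inv, hνc, mul_inv_cancel]
    · simp [c, commutatorElement_def, mul_assoc]
  · rintro _ ⟨a, ha, rfl⟩ hz
    have hc (h : H) : c h a = a := by
      ext
      simp only [c, MulEquiv.toMonoidHom_eq_coe, MonoidHom.coe_coe, MulAut.conjNormal_apply]
      rw [mul_inv_eq_iff_eq_mul]
      exact Subgroup.mem_center_iff.mp hz h
    have ha' : ν a = 1 := ha
    rw [hν, Finset.prod_congr rfl fun h _ ↦ hc h, Finset.prod_const, Finset.card_univ,
      ← Nat.card_eq_fintype_card] at ha'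
    exact congrArg Subtype.val ha'

theorem Subgroup.Normal.commutator_mem_left {G : Type*} [Group G] {B : Subgroup G} (hB : B.Normal)
    {b : G} (hb : b ∈ B) (g : G) : ⁅b, g⁆ ∈ B := by
  rw [commutatorElement_def, mul_assoc, mul_assoc, ← mul_assoc g]
  exact B.mul_mem hb (hB.conj_mem _ (B.inv_mem hb) g)

/-- A subgroup of a nilpotent group which contains every element that is central modulo it is the
whole group. -/
theorem Group.IsNilpotent.eq_top_of_forall_commutator_mem {N : Type*} [Group N]
    [Group.IsNilpotent N] (L : Subgroup N) (h : ∀ x, (∀ y, ⁅x, y⁆ ∈ L) → x ∈ L) : L = ⊤ := by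
  obtain ⟨n, hn⟩ := Group.IsNilpotent.nilpotent N
  have key (m : ℕ) : Subgroup.upperCentralSeries N m ≤ L := by
    induction m with
    | zero => simp
    | succ m ih =>
      intro x hx
      rw [Subgroup.mem_upperCentralSeries_succ_iff] at hx
      exact h x fun y ↦ ih (hx y)
  exact eq_top_iff.mpr (hn ▸ key n)

theorem inv_mul_commute_of_commutator_eq {G : Type*} [Group G] {x y h : G}
    (hxy : ⁅x, h⁆ = ⁅y, h⁆) : y⁻¹ * x * h = h * (y⁻¹ * x) := by
  simp only [commutatorElement_def, mul_left_inj] at hxy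
  rw [mul_inv_eq_iff_eq_mul] at hxy
  rw [mul_assoc, hxy]
  group

theorem commutator_mul_of_mem_center {G : Type*} [Group G] {c : G} (hc : c ∈ Subgroup.center G)
    (b g : G) : ⁅b * c, g⁆ = ⁅b, g⁆ := by
  simp only [commutatorElement_def, mul_inv_rev]
  rw [mul_assoc b c g, ← Subgroup.mem_center_iff.mp hc g]
  group

theorem exists_commutator_eq {G : Type*} [Group G] [Finite G] {B : Subgroup G}
    (hB : B.Normal) {h : G} (hh : ∀ x ∈ B, x * h = h * x → x = 1) : ∀ b ∈ B, ∃ a ∈ B, ⁅a, h⁆ = b := by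
  let φ : B → B := fun b ↦ ⟨⁅(b : G), h⁆, hB.commutator_mem_left b.2 h⟩
  have hφ : Function.Surjective φ := by
    refine Finite.surjective_of_injective fun a b hab ↦ ?_
    have h1 := hh _ (B.mul_mem (B.inv_mem b.2) a.2)
      (inv_mul_commute_of_commutator_eq (congrArg Subtype.val hab))
    exact Subtype.ext (inv_mul_eq_one.mp h1).symm
  intro b hb
  obtain ⟨a, ha⟩ := hφ ⟨b, hb⟩
  exact ⟨a, a.2, congrArg Subtype.val ha⟩

/-- If no commutator of an element of `N` is nontrivial and central in a quotient of `G`, and a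
coprime complement `H` of the nilpotent normal subgroup `N` has an element with only central fixed
points on `N`, then `N = [N, H] × (N ∩ Z(G))`. -/
theorem commutator_inf_center_eq_bot_and_le_sup {G : Type*} [Group G] [Finite G] {N H : Subgroup G}
    [N.Normal] [Group.IsNilpotent N] (hNH : N ⊔ H = ⊤) (hco : (Nat.card N).Coprime (Nat.card H))
    {h : G} (hH : h ∈ H) (hh : ∀ x ∈ N, x * h = h * x → x ∈ Subgroup.center G)
    (hV : ∀ K : Subgroup G, K.Normal → ∀ x ∈ N, ∀ y, (∀ g, ⁅⁅x, y⁆, g⁆ ∈ K) → ⁅x, y⁆ ∈ K) :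
    ⁅N, H⁆.Normal ∧ ⁅N, H⁆ ≤ N ∧ ⁅N, H⁆ ⊓ Subgroup.center G = ⊥ ∧
      ∀ x ∈ N, ∃ b ∈ ⁅N, H⁆, b⁻¹ * x ∈ Subgroup.center G := by
  let P : Subgroup G → Prop := fun B ↦ B.Normal ∧ B ≤ N ∧ B ⊓ Subgroup.center G = ⊥
  obtain ⟨B, ⟨hB, hBN, hBZ⟩, hmax⟩ : ∃ B, Maximal P B :=
    (Set.toFinite {B | P B}).exists_maximal ⟨⊥, inferInstance, bot_le, bot_inf_eq _⟩
  have hNH' (g : G) : ∃ n ∈ N, ∃ k ∈ H, g = n * k := by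
    obtain ⟨n, hn, k, hk, e⟩ := Subgroup.mem_sup_of_normal_left.mp (hNH ▸ Subgroup.mem_top g)
    exact ⟨n, hn, k, hk, e.symm⟩
  have hT : ∀ x ∈ N, (∀ y ∈ N, ⁅x, y⁆ ∈ B) → ⁅x, h⁆ ∈ B := by
    let π := QuotientGroup.mk' B
    have hπ : Function.Surjective π := QuotientGroup.mk'_surjective B
    have hπB (g : G) : π g = 1 ↔ g ∈ B := QuotientGroup.eq_one_iff g
    let A : Subgroup (G ⧸ B) := N.map π ⊓ Subgroup.centralizer (N.map π : Set (G ⧸ B))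
    have : (N.map π).Normal := Subgroup.Normal.map ‹_› π hπ
    have : A.Normal := inferInstance
    have : IsMulCommutative A :=
      ⟨⟨fun a b ↦ Subtype.ext (Subgroup.mem_centralizer_iff.mp b.2.2 _ a.2.1)⟩⟩
    obtain ⟨K, hKA, hK, hcK, hpow⟩ := A.exists_norm_kernel (H.map π) fun q ↦ by
      obtain ⟨g, rfl⟩ := hπ q
      obtain ⟨n, hn, k, hk, rfl⟩ := hNH' g
      refine ⟨π n, ?_, π k, Subgroup.mem_map_of_mem π hk, map_mul π n k⟩
      exact Subgroup.mem_centralizer_iff.mpr fun a ha ↦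
        (Subgroup.mem_centralizer_iff.mp ha.2 _ (Subgroup.mem_map_of_mem π hn)).symm
    have hBK : B ≤ K.comap π := fun b hb ↦ by
      rw [Subgroup.mem_comap, (hπB b).mpr hb]
      exact K.one_mem
    have hKN : K.comap π ≤ N := fun x hx ↦ by
      obtain ⟨n, hn, e⟩ := (hKA hx).1
      have := hBN ((hπB (n⁻¹ * x)).mp (by rw [map_mul, map_inv, e, inv_mul_cancel]))
      simpa using N.mul_mem hn this
    have hKP : P (K.comap π) := by
      refine ⟨inferInstance, hKN, (Subgroup.eq_bot_iff_forall _).mpr fun x ⟨hxK, hxZ⟩ ↦ ?_⟩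
      have hxZ' : π x ∈ Subgroup.center (G ⧸ B) := Subgroup.mem_center_iff.mpr fun q ↦ by
        obtain ⟨g, rfl⟩ := hπ q
        rw [← map_mul, ← map_mul, Subgroup.mem_center_iff.mp hxZ g]
      have h1 : π x ^ Nat.card H = 1 := by
        obtain ⟨m, hm⟩ := Subgroup.card_map_dvd π (H := H)
        rw [hm, pow_mul, hpow _ hxK hxZ', one_pow]
      rw [← map_pow, hπB] at h1
      have h2 : x ^ Nat.card H ∈ B ⊓ Subgroup.center G :=
        ⟨h1, (Subgroup.center G).pow_mem hxZ _⟩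
      rw [hBZ, Subgroup.mem_bot, ← orderOf_dvd_iff_pow_eq_one] at h2
      have h3 : orderOf x ∣ Nat.card N := Subgroup.orderOf_dvd_natCard N (hKN hxK)
      exact orderOf_eq_one_iff.mp (Nat.eq_one_of_dvd_coprimes hco h3 h2)
    have hKB : K.comap π ≤ B := hmax hKP hBK
    intro x hx hxN
    refine hKB ?_
    rw [Subgroup.mem_comap, map_commutatorElement]
    refine hcK _ ⟨Subgroup.mem_map_of_mem π hx, ?_⟩ _ (Subgroup.mem_map_of_mem π hH)
    refine Subgroup.mem_centralizer_iff.mpr ?_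
    rintro _ ⟨y, hy, rfl⟩
    have := (hπB _).mpr (hxN y hy)
    rw [map_commutatorElement, commutatorElement_eq_one_iff_mul_comm] at this
    exact this.symm
  have hsurj : ∀ b ∈ B, ∃ a ∈ B, ⁅a, h⁆ = b := exists_commutator_eq hB fun x hx hxh ↦ by
    have : x ∈ B ⊓ Subgroup.center G := ⟨hx, hh x (hBN hx) hxh⟩
    rwa [hBZ, Subgroup.mem_bot] at this
  have hBC : (B ⊔ Subgroup.center G).subgroupOf N = ⊤ := by
    refine Group.IsNilpotent.eq_top_of_forall_commutator_mem _ fun x hx ↦ ?_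
    have hxB : ∀ y ∈ N, ⁅(x : G), y⁆ ∈ B := by
      intro y hy
      refine hV B hB x x.2 y fun g ↦ ?_
      obtain ⟨b, hb, c, hc, e⟩ :=
        Subgroup.mem_sup_of_normal_left.mp (Subgroup.mem_subgroupOf.mp (hx ⟨y, hy⟩))
      have e' : ⁅(x : G), y⁆ = b * c := e.symm
      rw [e', commutator_mul_of_mem_center hc]
      exact hB.commutator_mem_left hb g
    obtain ⟨b, hb, hbx⟩ := hsurj _ (hT x x.2 hxB)
    rw [Subgroup.mem_subgroupOf, ← mul_inv_cancel_left b (x : G)]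
    exact Subgroup.mul_mem_sup hb
      (hh _ (N.mul_mem (N.inv_mem (hBN hb)) x.2) (inv_mul_commute_of_commutator_eq hbx.symm))
  have hdec : ∀ x ∈ N, ∃ b ∈ B, b⁻¹ * x ∈ Subgroup.center G := by
    intro x hx
    obtain ⟨b, hb, c, hc, rfl⟩ := Subgroup.mem_sup_of_normal_left.mp
      (Subgroup.subgroupOf_eq_top.mp hBC hx)
    exact ⟨b, hb, by rwa [inv_mul_cancel_left]⟩
  have hNHB : ⁅N, H⁆ = B := by
    apply le_antisymm
    · rw [Subgroup.commutator_le]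
      intro x hx k _
      obtain ⟨b, hb, hc⟩ := hdec x hx
      rw [← mul_inv_cancel_left b x, commutator_mul_of_mem_center hc]
      exact hB.commutator_mem_left hb k
    · intro b hb
      obtain ⟨a, ha, rfl⟩ := hsurj b hb
      exact Subgroup.commutator_mem_commutator (hBN ha) hH
  rw [hNHB]
  exact ⟨hB, hBN, hBZ, hdec⟩

/-- Proposition 3.5: for a group as in case (b) of Theorem 3.3,
`G = C_N(H) × M` with `C_N(H) ≤ Z(G)`, `M = [N,H]H` the normal closure of `H`,
`M/C_H(N)` a Frobenius group whose kernel `[N,H]C_H(N)/C_H(N)` contains no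
vanishing element of `M/C_H(N)`, and `s = |[N,H]|`. -/
theorem statement13 (G : Type) [Group G] [Finite G] (s : ℕ) (hs : 0 < s)
    (hvcs : vcs G = {s})
    (N H : Subgroup G) (hN : N.Normal) (hNnil : Group.IsNilpotent ↥N)
    (hNhall : IsHallSubgroup (primesOf s) N)
    (hHhall : IsHallSubgroup (primesOf s)ᶜ H)
    (hHab : IsAbelianSubgroup H) (hNH : N ⊔ H = ⊤)
    (hFrob : IsFrobenius (N.map (QuotientGroup.mk' (Subgroup.center G)))
      (H.map (QuotientGroup.mk' (Subgroup.center G))))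
    (hcard : Nat.card (N.map (QuotientGroup.mk' (Subgroup.center G))) = s)
    (hnov : ∀ x ∈ N, ¬ IsVanishing G x) :
    Subgroup.centralizer (H : Set G) ⊓ N ≤ Subgroup.center G ∧
    ⁅N, H⁆ ⊔ H = Subgroup.normalClosure (H : Set G) ∧
    (Subgroup.centralizer (H : Set G) ⊓ N) ⊓ (⁅N, H⁆ ⊔ H) = ⊥ ∧
    (Subgroup.centralizer (H : Set G) ⊓ N) ⊔ (⁅N, H⁆ ⊔ H) = ⊤ ∧
    (∀ a ∈ Subgroup.centralizer (H : Set G) ⊓ N, ∀ b ∈ ⁅N, H⁆ ⊔ H, Commute a b) ∧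
    (∀ _hn : ((Subgroup.centralizer (N : Set G) ⊓ H).subgroupOf (⁅N, H⁆ ⊔ H)).Normal,
      IsFrobeniusWithKernel
        (((⁅N, H⁆ ⊔ (Subgroup.centralizer (N : Set G) ⊓ H)).subgroupOf (⁅N, H⁆ ⊔ H)).map
          (QuotientGroup.mk'
            ((Subgroup.centralizer (N : Set G) ⊓ H).subgroupOf (⁅N, H⁆ ⊔ H)))) ∧
      ∀ x ∈ (((⁅N, H⁆ ⊔ (Subgroup.centralizer (N : Set G) ⊓ H)).subgroupOf (⁅N, H⁆ ⊔ H)).map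
          (QuotientGroup.mk'
            ((Subgroup.centralizer (N : Set G) ⊓ H).subgroupOf (⁅N, H⁆ ⊔ H)))),
        ¬ IsVanishing _ x) ∧
    Nat.card ↥(⁅N, H⁆ : Subgroup G) = s := by
  let Z := Subgroup.center G
  let π := QuotientGroup.mk' Z
  obtain ⟨⟨hNbot, hNtop, -, hcent⟩, hsup, hinf⟩ := hFrob
  have hπ (g : G) : π g = 1 ↔ g ∈ Z := QuotientGroup.eq_one_iff g
  have hco : (Nat.card N).Coprime (Nat.card H) := Nat.coprime_of_dvd fun p hp h1 h2 ↦
    hHhall.1 p hp h2 (hNhall.1 p hp h1)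
  have hNHbot : N ⊓ H = ⊥ := (Subgroup.disjoint_of_coprime_natCard hco).eq_bot
  have hNH' (g : G) : ∃ n ∈ N, ∃ k ∈ H, g = n * k := by
    obtain ⟨n, hn, k, hk, e⟩ := Subgroup.mem_sup_of_normal_left.mp (hNH ▸ Subgroup.mem_top g)
    exact ⟨n, hn, k, hk, e.symm⟩
  have hmem : ∀ k ∈ H, π k ∈ N.map π → k ∈ Z := by
    intro k hk hkN
    have : π k ∈ N.map π ⊓ H.map π := ⟨hkN, Subgroup.mem_map_of_mem π hk⟩
    rw [hinf, Subgroup.mem_bot] at this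
    exact (hπ k).mp this
  have hcent' : ∀ x ∈ N, x ∉ Z → ∀ g, x * g = g * x → π g ∈ N.map π := by
    intro x hx hxZ g hg
    refine hcent (π x) (Subgroup.mem_map_of_mem π hx) (fun h ↦ hxZ ((hπ x).mp h)) ?_
    rw [Subgroup.mem_centralizer_singleton_iff, ← map_mul, ← map_mul, hg]
  obtain ⟨h, hH, hhZ⟩ : ∃ h ∈ H, h ∉ Z := by
    by_contra! hall
    refine hNtop (top_le_iff.mp (hsup ▸ sup_le le_rfl ?_))
    rintro _ ⟨k, hk, rfl⟩
    rw [(hπ k).mpr (hall k hk)]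
    exact Subgroup.one_mem _
  have hh : ∀ x ∈ N, x * h = h * x → x ∈ Z := fun x hx hxh ↦ by
    by_contra hxZ
    exact hhZ (hmem h hH (hcent' x hx hxZ h hxh))
  obtain ⟨hB, hBN, hBZ, hdec⟩ := commutator_inf_center_eq_bot_and_le_sup hNH hco hH hh
    fun K hK x hx y ↦ commutator_mem_of_not_isVanishing K (hnov x hx)
  set B : Subgroup G := ⁅N, H⁆
  set M : Subgroup G := B ⊔ H
  set C : Subgroup G := Subgroup.centralizer (H : Set G) ⊓ N
  set K₀ : Subgroup G := Subgroup.centralizer (N : Set G) ⊓ H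
  have hBM : B ≤ M := le_sup_left
  have hHM : H ≤ M := le_sup_right
  have hBZ' : ∀ b ∈ B, b ∈ Z → b = 1 := fun b hb hbZ ↦ by
    have : b ∈ B ⊓ Z := ⟨hb, hbZ⟩
    rwa [hBZ, Subgroup.mem_bot] at this
  have hNH1 : ∀ x ∈ N, x ∈ H → x = 1 := fun x hx hxH ↦ by
    have : x ∈ N ⊓ H := ⟨hx, hxH⟩
    rwa [hNHbot, Subgroup.mem_bot] at this
  have hCZ : C ≤ Z := fun x hx ↦ hh x hx.2 (Subgroup.mem_centralizer_iff.mp hx.1 h hH).symm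
  have hZC : ∀ x ∈ N, x ∈ Z → x ∈ C := fun x hx hxZ ↦ ⟨Subgroup.center_le_centralizer _ hxZ, hx⟩
  have hM (m : G) : m ∈ M ↔ ∃ b ∈ B, ∃ k ∈ H, b * k = m := Subgroup.mem_sup_of_normal_left
  have hMC (g : G) : ∃ c ∈ C, ∃ m ∈ M, g = c * m := by
    obtain ⟨n, hn, k, hk, rfl⟩ := hNH' g
    obtain ⟨b, hb, hbn⟩ := hdec n hn
    refine ⟨b⁻¹ * n, hZC _ (N.mul_mem (N.inv_mem (hBN hb)) hn) hbn, b * k,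
      M.mul_mem (hBM hb) (hHM hk), ?_⟩
    rw [← mul_assoc, ← Subgroup.mem_center_iff.mp hbn b, mul_inv_cancel_left]
  have hMnormal : M.Normal := ⟨fun m hm g ↦ by
    obtain ⟨c, hc, u, hu, rfl⟩ := hMC g
    have : c * u * m * (c * u)⁻¹ = u * m * u⁻¹ := by
      rw [mul_assoc c u m, ← Subgroup.mem_center_iff.mp (hCZ hc) (u * m),
        ← Subgroup.mem_center_iff.mp (hCZ hc) u]
      group
    rw [this]
    exact M.mul_mem (M.mul_mem hu hm) (M.inv_mem hu)⟩
  have hCM : ∀ x ∈ C, x ∈ M → x = 1 := fun x hxC hxM ↦ by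
    obtain ⟨b, hb, k, hk, rfl⟩ := (hM x).mp hxM
    have hkN : k ∈ N := (N.mul_mem_cancel_left (hBN hb)).mp hxC.2
    rw [hNH1 k hkN hk, mul_one] at hxC ⊢
    exact hBZ' b hb (hCZ hxC)
  have hK₀Z : K₀ ≤ Z := fun x hx ↦ Subgroup.mem_center_iff.mpr fun g ↦ by
    obtain ⟨n, hn, k, hk, rfl⟩ := hNH' g
    rw [mul_assoc, hHab k hk x hx.2, ← mul_assoc, Subgroup.mem_centralizer_iff.mp hx.1 n hn,
      mul_assoc]
  have hZK₀ : ∀ x ∈ H, x ∈ Z → x ∈ K₀ := fun x hx hxZ ↦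
    ⟨Subgroup.center_le_centralizer _ hxZ, hx⟩
  refine ⟨hCZ, ?_, ?_, ?_, ?_, fun hn ↦ ?_, ?_⟩
  · refine le_antisymm (sup_le ?_ Subgroup.subset_normalClosure)
      (Subgroup.normalClosure_le_normal hHM)
    rw [Subgroup.commutator_le]
    intro x _ k hk
    have hk' := Subgroup.subset_normalClosure (s := (H : Set G)) hk
    exact mul_mem (Subgroup.normalClosure_normal.conj_mem k hk' x) (inv_mem hk')
  · exact (Subgroup.eq_bot_iff_forall _).mpr fun x hx ↦ hCM x hx.1 hx.2
  · refine top_le_iff.mp fun g _ ↦ ?_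
    obtain ⟨c, hc, m, hm, rfl⟩ := hMC g
    exact Subgroup.mul_mem_sup hc hm
  · exact fun a ha b _ ↦ (Subgroup.mem_center_iff.mp (hCZ ha) b).symm
  · let q := QuotientGroup.mk' (K₀.subgroupOf M)
    have hqsurj : Function.Surjective q := QuotientGroup.mk'_surjective _
    have hq (m : M) : q m = 1 ↔ (m : G) ∈ K₀ := QuotientGroup.eq_one_iff m
    have hL : ∀ x ∈ ((B ⊔ K₀).subgroupOf M).map q, ∃ b, ∃ hb : b ∈ B, x = q ⟨b, hBM hb⟩ := by
      rintro _ ⟨m, hm, rfl⟩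
      obtain ⟨b, hb, k, hk, e⟩ := Subgroup.mem_sup_of_normal_left.mp (Subgroup.mem_subgroupOf.mp hm)
      refine ⟨b, hb, ?_⟩
      rw [← inv_mul_eq_one, ← map_inv, ← map_mul, hq, ← inv_mem_iff]
      simpa [← e] using hk
    have hBL (b : G) (hb : b ∈ B) : q ⟨b, hBM hb⟩ ∈ ((B ⊔ K₀).subgroupOf M).map q :=
      Subgroup.mem_map_of_mem q (Subgroup.mem_subgroupOf.mpr (Subgroup.mem_sup_left hb))
    refine ⟨⟨?_, ?_, ?_, ?_⟩, ?_⟩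
    · intro hbot
      refine hNbot ((Subgroup.eq_bot_iff_forall _).mpr ?_)
      rintro _ ⟨n, hn, rfl⟩
      obtain ⟨b, hb, hbn⟩ := hdec n hn
      have hb1 := hBL b hb
      rw [hbot, Subgroup.mem_bot, hq] at hb1
      rw [hBZ' b hb (hK₀Z hb1), inv_one, one_mul] at hbn
      exact (hπ n).mpr hbn
    · intro htop
      obtain ⟨b, hb, e⟩ := hL (q ⟨h, hHM hH⟩) (htop ▸ Subgroup.mem_top _)
      rw [← mul_inv_eq_one, ← map_inv, ← map_mul, hq] at e
      have hbh : h * b⁻¹ ∈ K₀ := e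
      have hbH : b ∈ H := inv_mem_iff.mp ((H.mul_mem_cancel_left hH).mp hbh.2)
      rw [hNH1 b (hBN hb) hbH, inv_one, mul_one] at hbh
      exact hhZ (hK₀Z hbh)
    · have : K₀.Normal := ⟨fun x hx g ↦ by
        rwa [Subgroup.mem_center_iff.mp (hK₀Z hx) g, mul_inv_cancel_right]⟩
      exact Subgroup.Normal.map inferInstance q hqsurj
    · intro x hx hx1 y hy
      obtain ⟨b, hb, rfl⟩ := hL x hx
      obtain ⟨⟨m, hm⟩, rfl⟩ := hqsurj y
      obtain ⟨a, ha, k, hk, rfl⟩ := (hM m).mp hm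
      have hbZ : b ∉ Z := fun hbZ ↦ hx1 ((hq _).mpr ((hBZ' b hb hbZ).symm ▸ K₀.one_mem))
      rw [Subgroup.mem_centralizer_singleton_iff, eq_comm, ← commutatorElement_eq_one_iff_mul_comm,
        ← map_commutatorElement, hq] at hy
      have hy' : ⁅b, a * k⁆ ∈ K₀ := hy
      have hcomm := hBZ' _ (hB.commutator_mem_left hb (a * k)) (hK₀Z hy')
      rw [commutatorElement_eq_one_iff_mul_comm] at hcomm
      have hak := hcent' b (hBN hb) hbZ (a * k) hcomm
      rw [map_mul, (N.map π).mul_mem_cancel_left (Subgroup.mem_map_of_mem π (hBN ha))] at hak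
      refine Subgroup.mem_map_of_mem q (Subgroup.mem_subgroupOf.mpr ?_)
      exact Subgroup.mul_mem_sup ha (hZK₀ k hk (hmem k hk hak))
    · intro x hx hvan
      obtain ⟨b, hb, rfl⟩ := hL x hx
      have : C.Normal := ⟨fun x hx g ↦ by
        rwa [Subgroup.mem_center_iff.mp (hCZ hx) g, mul_inv_cancel_right]⟩
      let φ : M →* G ⧸ C := (QuotientGroup.mk' C).comp M.subtype
      have hφ : Function.Bijective φ := by
        refine ⟨(injective_iff_map_eq_one φ).mpr fun m hm ↦ ?_, fun y ↦ ?_⟩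
        · exact Subtype.ext (hCM m ((QuotientGroup.eq_one_iff (m : G)).mp hm) m.2)
        · obtain ⟨g, rfl⟩ := QuotientGroup.mk'_surjective C y
          obtain ⟨c, hc, m, hm, rfl⟩ := hMC g
          refine ⟨⟨m, hm⟩, ?_⟩
          have : QuotientGroup.mk' C c = 1 := (QuotientGroup.eq_one_iff c).mpr hc
          rw [map_mul, this, one_mul]
          rfl
      let e := MulEquiv.ofBijective φ hφ
      let f : G →* M ⧸ K₀.subgroupOf M := (q.comp e.symm.toMonoidHom).comp (QuotientGroup.mk' C)
      have hf : Function.Surjective f :=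
        (hqsurj.comp e.symm.surjective).comp (QuotientGroup.mk'_surjective C)
      have hfb : f b = q ⟨b, hBM hb⟩ := congrArg q (e.symm_apply_apply ⟨b, hBM hb⟩)
      rw [← hfb] at hvan
      exact hnov b (hBN hb) (hvan.of_surjective f hf)
  · have himg : N.map π = B.map π := by
      refine le_antisymm ?_ (Subgroup.map_mono hBN)
      rintro _ ⟨n, hn, rfl⟩
      obtain ⟨b, hb, hbn⟩ := hdec n hn
      refine ⟨b, hb, ?_⟩
      rw [← inv_mul_eq_one, ← map_inv, ← map_mul, hπ]
      exact hbn
    have hinj : Set.InjOn π B := fun a ha b hb hab ↦ by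
      rw [← inv_mul_eq_one, ← map_inv, ← map_mul, hπ] at hab
      exact inv_mul_eq_one.mp (hBZ' _ (B.mul_mem (B.inv_mem ha) hb) hab)
    rw [← hcard, himg]
    exact (Nat.card_image_of_injOn hinj).symm
end
end

section
/- Let G be a finite group with vcs(G) = {s}, let p be a prime divisor of s, and let P be a Sylow p-subgroup of G. Let X be a normal subgroup of G with Z(Fit(G)) ≤ X ≤ Fit(G) such that every element of G \ X is a vanishing element of G. Then Z(P) ≤ Z(Fit(G)); in particular, if P is abelian, then |G/X| is not divisible by p. Furthermore, either G/X is cyclic of order coprime to s, or every nontrivial element of G/X has prime order. -/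
open scoped Classical

noncomputable section

section Elements

variable {G : Type*} [Group G]

/-- The centralizer of a single element. -/
abbrev cent (g : G) : Subgroup G := Subgroup.centralizer {g}

theorem mem_cent {g x : G} : x ∈ cent g ↔ Commute x g := by
  rw [Subgroup.mem_centralizer_singleton_iff]; exact Iff.rfl

theorem self_mem_cent (g : G) : g ∈ cent g := mem_cent.2 (Commute.refl g)

theorem mem_cent_comm {g x : G} : x ∈ cent g ↔ g ∈ cent x := by
  rw [mem_cent, mem_cent]; exact ⟨Commute.symm, Commute.symm⟩

theorem cent_le_cent_pow (g : G) (n : ℕ) : cent g ≤ cent (g ^ n) :=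
  fun _ hx => mem_cent.2 ((mem_cent.1 hx).pow_right n)

theorem conj_mem_cent {g x : G} (n : G) : n * x * n⁻¹ ∈ cent (n * g * n⁻¹) ↔ x ∈ cent g := by
  rw [mem_cent, mem_cent]
  exact SemiconjBy.conj_iff

/-- The order of `g` is a power of `p`. -/
def IsPElement (p : ℕ) (g : G) : Prop := ∃ k : ℕ, g ^ p ^ k = 1

theorem IsPElement.one (p : ℕ) : IsPElement p (1 : G) := ⟨0, by simp⟩

theorem IsPElement.pow {p : ℕ} {g : G} (h : IsPElement p g) (n : ℕ) : IsPElement p (g ^ n) := by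
  obtain ⟨k, hk⟩ := h
  exact ⟨k, by rw [← pow_mul, mul_comm, pow_mul, hk, one_pow]⟩

theorem IsPElement.inv {p : ℕ} {g : G} (h : IsPElement p g) : IsPElement p g⁻¹ := by
  obtain ⟨k, hk⟩ := h
  exact ⟨k, by rw [inv_pow, hk, inv_one]⟩

theorem IsPElement.conj {p : ℕ} {g : G} (h : IsPElement p g) (n : G) :
    IsPElement p (n * g * n⁻¹) := by
  obtain ⟨k, hk⟩ := h
  exact ⟨k, by rw [conj_pow, hk]; simp⟩

theorem IsPElement.mul_of_commute {p : ℕ} {g h : G} (hg : IsPElement p g) (hh : IsPElement p h)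
    (hc : Commute g h) : IsPElement p (g * h) := by
  obtain ⟨k, hk⟩ := hg
  obtain ⟨l, hl⟩ := hh
  refine ⟨k + l, ?_⟩
  rw [hc.mul_pow, pow_add, pow_mul, hk, one_pow, mul_comm (p ^ k), pow_mul, hl, one_pow, one_mul]

theorem IsPElement.map {H : Type*} [Group H] (f : G →* H) {p : ℕ} {g : G} (h : IsPElement p g) :
    IsPElement p (f g) := by
  obtain ⟨k, hk⟩ := h
  exact ⟨k, by rw [← map_pow, hk, map_one]⟩

theorem IsPElement.of_mem {p : ℕ} {P : Subgroup G} (hP : IsPGroup p P) {g : G} (hg : g ∈ P) :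
    IsPElement p g := by
  obtain ⟨k, hk⟩ := hP ⟨g, hg⟩
  exact ⟨k, by simpa using congrArg Subtype.val hk⟩

theorem isPGroup_of_forall_isPElement {p : ℕ} {P : Subgroup G} (h : ∀ g ∈ P, IsPElement p g) :
    IsPGroup p P := by
  rintro ⟨g, hg⟩
  obtain ⟨k, hk⟩ := h g hg
  exact ⟨k, Subtype.ext (by simpa using hk)⟩

theorem isPElement_of_pow_prime_eq_one {p : ℕ} {g : G} (h : g ^ p = 1) : IsPElement p g :=
  ⟨1, by simpa using h⟩

theorem IsPElement.isPGroup_zpowers {p : ℕ} {g : G} (h : IsPElement p g) :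
    IsPGroup p (Subgroup.zpowers g) := by
  refine isPGroup_of_forall_isPElement fun x hx => ?_
  obtain ⟨k, hk⟩ := h
  obtain ⟨n, rfl⟩ := Subgroup.mem_zpowers_iff.1 hx
  exact ⟨k, by rw [← zpow_natCast, ← zpow_mul, mul_comm, zpow_mul, zpow_natCast, hk, one_zpow]⟩

theorem IsPElement.orderOf_dvd {p : ℕ} {g : G} (h : IsPElement p g) :
    ∃ k, orderOf g ∣ p ^ k := by
  obtain ⟨k, hk⟩ := h
  exact ⟨k, orderOf_dvd_of_pow_eq_one hk⟩

theorem IsPElement.coprime {p q : ℕ} (hp : p.Prime) (hq : q.Prime) (hpq : p ≠ q) {g h : G}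
    (hg : IsPElement p g) (hh : IsPElement q h) : (orderOf g).Coprime (orderOf h) := by
  obtain ⟨k, hk⟩ := hg.orderOf_dvd
  obtain ⟨l, hl⟩ := hh.orderOf_dvd
  exact Nat.Coprime.of_dvd hk hl (Nat.coprime_pow_primes k l hp hq hpq)

theorem IsPElement.coprime_right {p : ℕ} {g : G} (hg : IsPElement p g) {n : ℕ}
    (hn : n.Coprime p) : n.Coprime (orderOf g) := by
  obtain ⟨k, hk⟩ := hg.orderOf_dvd
  exact Nat.Coprime.coprime_dvd_right hk (hn.pow_right k)

theorem IsPElement.eq_one_of_coprime {p : ℕ} {g : G} (hg : IsPElement p g)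
    (h : (orderOf g).Coprime p) : g = 1 := by
  have := hg.coprime_right h
  rw [Nat.coprime_self] at this
  exact orderOf_eq_one_iff.1 this

theorem IsPElement.eq_one_of_isPElement {p q : ℕ} (hp : p.Prime) (hq : q.Prime) (hpq : p ≠ q)
    {g : G} (hg : IsPElement p g) (h : IsPElement q g) : g = 1 := by
  have := hg.coprime hp hq hpq h
  rw [Nat.coprime_self] at this
  exact orderOf_eq_one_iff.1 this

/-- Exponents which simultaneously extract the `p`-part and the `p'`-part of every element. -/
theorem exists_primePart_exponents (G : Type*) [Group G] [Finite G] {p : ℕ} (hp : p.Prime) :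
    ∃ b b' : ℕ, ∀ g : G, g ^ b * g ^ b' = g ∧ IsPElement p (g ^ b) ∧
      (orderOf (g ^ b')).Coprime p ∧ (IsPElement p g → g ^ b = g) ∧
      ((orderOf g).Coprime p → g ^ b = 1) := by
  obtain ⟨a, m, hm, hn⟩ := Nat.exists_eq_pow_mul_and_not_dvd (Nat.card_pos (α := G)).ne' p hp.ne_one
  have hcop : m.Coprime p := ((Nat.Prime.coprime_iff_not_dvd hp).2 hm).symm
  have hcop' : (p ^ a).Coprime m := (hcop.pow_right a).symm
  obtain ⟨b, hb1, hb2⟩ := Nat.chineseRemainder hcop' 1 0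
  obtain ⟨b', hb1', hb2'⟩ := Nat.chineseRemainder hcop' 0 1
  refine ⟨b, b', fun g => ?_⟩
  have hord : orderOf g ∣ p ^ a * m := hn ▸ orderOf_dvd_natCard g
  have hgn : g ^ (p ^ a * m) = 1 := orderOf_dvd_iff_pow_eq_one.1 hord
  refine ⟨?_, ?_, ?_, ?_, ?_⟩
  · have h : b + b' ≡ 1 [MOD p ^ a * m] :=
      (Nat.modEq_and_modEq_iff_modEq_mul hcop').1 ⟨by simpa using hb1.add hb1', by
        simpa using hb2.add hb2'⟩
    rw [← pow_add]
    simpa using pow_eq_pow_iff_modEq.2 (h.of_dvd hord)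
  · obtain ⟨d, hd⟩ := (Nat.modEq_zero_iff_dvd).1 hb2
    refine ⟨a, ?_⟩
    rw [hd, ← pow_mul, show m * d * p ^ a = p ^ a * m * d by ring, pow_mul, hgn, one_pow]
  · refine Nat.Coprime.coprime_dvd_left (orderOf_dvd_of_pow_eq_one (n := m) ?_) hcop
    obtain ⟨d, hd⟩ := (Nat.modEq_zero_iff_dvd).1 hb1'
    rw [hd, ← pow_mul, show p ^ a * d * m = p ^ a * m * d by ring, pow_mul, hgn, one_pow]
  · intro hg
    have h : orderOf g ∣ p ^ a :=
      (Nat.Coprime.symm (hg.coprime_right hcop)).dvd_of_dvd_mul_right hord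
    simpa using pow_eq_pow_iff_modEq.2 (hb1.of_dvd h)
  · intro hg
    have h : orderOf g ∣ m := (hg.pow_right a).dvd_of_dvd_mul_left hord
    exact orderOf_dvd_iff_pow_eq_one.1 (h.trans ((Nat.modEq_zero_iff_dvd).1 hb2))

theorem exists_isPElement_pow_notMem [Finite G] {N : Subgroup G} {g : G} (hg : g ∉ N) :
    ∃ q j : ℕ, q.Prime ∧ IsPElement q (g ^ j) ∧ g ^ j ∉ N := by
  by_contra! hcon
  have key : ∀ n : ℕ, ∀ h : G, (∃ j, h = g ^ j) → orderOf h = n → h ∈ N := by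
    intro n
    induction n using Nat.strong_induction_on with
    | _ n ih =>
      rintro h ⟨j, rfl⟩ hn
      by_cases h1 : n = 1
      · rw [h1, orderOf_eq_one_iff] at hn; rw [hn]; exact N.one_mem
      obtain ⟨q, hq, hqn⟩ := Nat.exists_prime_and_dvd h1
      obtain ⟨b, b', hb⟩ := exists_primePart_exponents G hq
      obtain ⟨e1, e2, e3, -, -⟩ := hb (g ^ j)
      rw [← e1]
      refine N.mul_mem ?_ ?_
      · rw [← pow_mul] at e2 ⊢
        exact hcon q _ hq e2
      · refine ih _ ?_ _ ⟨j * b', by rw [pow_mul]⟩ rfl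
        refine lt_of_le_of_ne (Nat.le_of_dvd (hn ▸ orderOf_pos _) (hn ▸ orderOf_pow_dvd b')) ?_
        intro h
        rw [h] at e3
        exact hq.one_lt.ne' (Nat.dvd_one.1 (e3 ▸ Nat.dvd_gcd hqn dvd_rfl))
  exact hg (key _ g ⟨1, by simp⟩ rfl)

theorem commute_mul_iff_of_coprime {u v x : G} (huv : Commute u v)
    (hcop : (orderOf u).Coprime (orderOf v)) :
    x ∈ cent (u * v) ↔ x ∈ cent u ∧ x ∈ cent v := by
  constructor
  · intro hx
    obtain ⟨a, ha1, ha2⟩ := Nat.chineseRemainder hcop 1 0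
    have h1 : (u * v) ^ a = u := by
      rw [huv.mul_pow, orderOf_dvd_iff_pow_eq_one.1 ((Nat.modEq_zero_iff_dvd).1 ha2), mul_one]
      simpa using pow_eq_pow_iff_modEq.2 ha1
    have h2 : x ∈ cent u := by
      have := cent_le_cent_pow (u * v) a hx
      rwa [h1] at this
    refine ⟨h2, ?_⟩
    have := (mem_cent.1 h2).inv_right.mul_right (mem_cent.1 hx)
    rw [inv_mul_cancel_left] at this
    exact mem_cent.2 this
  · rintro ⟨h1, h2⟩
    exact mem_cent.2 ((mem_cent.1 h1).mul_right (mem_cent.1 h2))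

end Elements

section Normal
variable {G : Type*} [Group G]

theorem card_sup_mul_card_inf (H K : Subgroup G) [K.Normal] :
    Nat.card ↥(H ⊔ K) * Nat.card ↥(H ⊓ K) = Nat.card H * Nat.card K := by
  have h1 := Subgroup.card_mul_index ((K.subgroupOf (H ⊔ K)))
  have h2 := Subgroup.card_mul_index ((K.subgroupOf H))
  have e : (K.subgroupOf (H ⊔ K)).index = (K.subgroupOf H).index := Subgroup.relIndex_sup_right H K
  rw [Nat.card_congr (Subgroup.subgroupOfEquivOfLe (le_sup_right : K ≤ H ⊔ K)).toEquiv] at h1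
  have h3 : Nat.card (K.subgroupOf H) = Nat.card ↥(H ⊓ K) := by
    rw [← Subgroup.inf_subgroupOf_left, Nat.card_congr (Subgroup.subgroupOfEquivOfLe
      (inf_le_left : H ⊓ K ≤ H)).toEquiv]
  rw [← h1, ← h2, e, h3]; ring

theorem isPGroup_sup_zpowers {p : ℕ} {K : Subgroup G} [K.Normal] (hK : IsPGroup p K) {g : G}
    (hg : IsPElement p g) : IsPGroup p ↥(K ⊔ Subgroup.zpowers g) := by
  rw [sup_comm]; exact IsPGroup.to_sup_of_normal_right hg.isPGroup_zpowers hK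

end Normal

section Splitting

variable {G : Type*} [Group G]

theorem orderOf_coprime_of_mem [Finite G] {t : ℕ} (ht : t.Prime) {Y : Subgroup G}
    (hY : ¬ t ∣ Nat.card Y) {y : G} (hy : y ∈ Y) : (orderOf y).Coprime t := by
  refine Nat.Coprime.coprime_dvd_left ?_ ((ht.coprime_iff_not_dvd.2 hY).symm)
  exact Subgroup.orderOf_dvd_natCard Y hy

theorem isPElement_of_not_dvd_eq_one [Finite G] {t : ℕ} (ht : t.Prime) {Y : Subgroup G}
    (hY : ¬ t ∣ Nat.card Y) {y : G} (hy : y ∈ Y) (h : IsPElement t y) : y = 1 :=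
  h.eq_one_of_coprime (orderOf_coprime_of_mem ht hY hy)

theorem IsPElement.exists_mem_sylow {t : ℕ} {g : G} (h : IsPElement t g) :
    ∃ P : Sylow t G, g ∈ P := by
  obtain ⟨P, hP⟩ := h.isPGroup_zpowers.exists_le_sylow
  exact ⟨P, hP (Subgroup.mem_zpowers g)⟩

/-- `N` is the product of a normal `t`-subgroup `K` and a normal `t'`-subgroup `Y`. -/
structure IsPrimeSplitting (t : ℕ) (N K Y : Subgroup G) : Prop where
  normal_left : K.Normal
  normal_right : Y.Normal
  isPGroup : IsPGroup t K
  not_dvd : ¬ t ∣ Nat.card Y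
  sup_eq : K ⊔ Y = N

namespace IsPrimeSplitting

variable {t : ℕ} {N K Y : Subgroup G}

theorem left_le (h : IsPrimeSplitting t N K Y) : K ≤ N := h.sup_eq ▸ le_sup_left

theorem right_le (h : IsPrimeSplitting t N K Y) : Y ≤ N := h.sup_eq ▸ le_sup_right

theorem exists_mul_eq (h : IsPrimeSplitting t N K Y) {g : G} (hg : g ∈ N) :
    ∃ k ∈ K, ∃ y ∈ Y, k * y = g := by
  have := h.normal_left
  rw [← h.sup_eq] at hg
  exact Subgroup.mem_sup_of_normal_left.1 hg

variable [Finite G]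

theorem inf_eq_bot (h : IsPrimeSplitting t N K Y) (ht : t.Prime) : K ⊓ Y = ⊥ := by
  rw [eq_bot_iff]
  rintro x ⟨hx1, hx2⟩
  exact isPElement_of_not_dvd_eq_one ht h.not_dvd hx2 (IsPElement.of_mem h.isPGroup hx1)

theorem commute (h : IsPrimeSplitting t N K Y) (ht : t.Prime) {k y : G} (hk : k ∈ K)
    (hy : y ∈ Y) : Commute k y :=
  Subgroup.commute_of_normal_of_disjoint K Y h.normal_left h.normal_right
    (disjoint_iff.2 (h.inf_eq_bot ht)) k y hk hy

theorem mem_left (h : IsPrimeSplitting t N K Y) (ht : t.Prime) {g : G} (hg : g ∈ N)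
    (hgt : IsPElement t g) : g ∈ K := by
  obtain ⟨b, b', hb⟩ := exists_primePart_exponents G ht
  obtain ⟨k, hk, y, hy, rfl⟩ := h.exists_mul_eq hg
  rw [← (hb (k * y)).2.2.2.1 hgt, (h.commute ht hk hy).mul_pow,
    (hb y).2.2.2.2 (orderOf_coprime_of_mem ht h.not_dvd hy), mul_one]
  exact K.pow_mem hk _

theorem mem_right (h : IsPrimeSplitting t N K Y) (ht : t.Prime) {g : G} (hg : g ∈ N)
    (hgt : (orderOf g).Coprime t) : g ∈ Y := by
  obtain ⟨b, b', hb⟩ := exists_primePart_exponents G ht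
  obtain ⟨k, hk, y, hy, rfl⟩ := h.exists_mul_eq hg
  have h1 := (hb (k * y)).2.2.2.2 hgt
  rw [(h.commute ht hk hy).mul_pow, (hb k).2.2.2.1 (IsPElement.of_mem h.isPGroup hk),
    (hb y).2.2.2.2 (orderOf_coprime_of_mem ht h.not_dvd hy), mul_one] at h1
  rw [h1, one_mul]; exact hy

theorem le_left (h : IsPrimeSplitting t N K Y) (ht : t.Prime) {P : Subgroup G} (hP : P ≤ N)
    (hPt : IsPGroup t P) : P ≤ K :=
  fun _ hx => h.mem_left ht (hP hx) (IsPElement.of_mem hPt hx)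

theorem inf (h : IsPrimeSplitting t N K Y) (ht : t.Prime) {X : Subgroup G} [hX : X.Normal]
    (hXN : X ≤ N) : IsPrimeSplitting t X (K ⊓ X) (Y ⊓ X) where
  normal_left := by have := h.normal_left; infer_instance
  normal_right := by have := h.normal_right; infer_instance
  isPGroup := h.isPGroup.to_le inf_le_left
  not_dvd := fun hd => h.not_dvd (hd.trans (Subgroup.card_dvd_of_le inf_le_left))
  sup_eq := by
    refine le_antisymm (sup_le inf_le_right inf_le_right) fun g hg => ?_
    obtain ⟨b, b', hb⟩ := exists_primePart_exponents G ht
    obtain ⟨k, hk, y, hy, hky⟩ := h.exists_mul_eq (hXN hg)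
    have h1 : g ^ b = k := by
      rw [← hky, (h.commute ht hk hy).mul_pow, (hb k).2.2.2.1 (IsPElement.of_mem h.isPGroup hk),
        (hb y).2.2.2.2 (orderOf_coprime_of_mem ht h.not_dvd hy), mul_one]
    have hkX : k ∈ X := h1 ▸ X.pow_mem hg b
    have hyX : y ∈ X := by
      have : y = k⁻¹ * g := by rw [← hky]; group
      rw [this]; exact X.mul_mem (X.inv_mem hkX) hg
    rw [← hky]
    exact Subgroup.mul_mem_sup ⟨hk, hkX⟩ ⟨hy, hyX⟩

end IsPrimeSplitting

/-- `N` splits as `N_t × N_{t'}` for every prime `t`. -/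
def HasPrimeSplittings (N : Subgroup G) : Prop :=
  ∀ t : ℕ, t.Prime → ∃ K Y, IsPrimeSplitting t N K Y

theorem HasPrimeSplittings.isNilpotent [Finite G] {N : Subgroup G} (hN : HasPrimeSplittings N) :
    Group.IsNilpotent N := by
  refine ((Group.isNilpotent_of_finite_tfae (G := N)).out 0 3).2 ?_
  intro t ht P
  obtain ⟨K, Y, h⟩ := hN t ht.out
  have hK := h.normal_left
  have : (P : Subgroup N) = K.subgroupOf N := by
    refine le_antisymm ?_ ?_
    · rintro ⟨x, hxN⟩ hx
      refine h.mem_left ht.out hxN ?_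
      simpa using (IsPElement.of_mem P.isPGroup' hx).map N.subtype
    · have h1 : IsPGroup t (K.subgroupOf N) := h.isPGroup.comap_subtype
      exact h1.le_sylow_of_normal P
  rw [this]
  infer_instance

theorem HasPrimeSplittings.mono [Finite G] {N X : Subgroup G} (hN : HasPrimeSplittings N)
    [X.Normal] (hX : X ≤ N) : HasPrimeSplittings X := fun t ht =>
  let ⟨_, _, h⟩ := hN t ht
  ⟨_, _, h.inf ht hX⟩

theorem isNilpotent_of_le {H N : Subgroup G} (hN : Group.IsNilpotent N) (h : H ≤ N) :
    Group.IsNilpotent H :=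
  (Group.isNilpotent_congr (Subgroup.subgroupOfEquivOfLe h)).1 inferInstance

theorem exists_greatest_normal_not_dvd (G : Type*) [Group G] [Finite G] {t : ℕ} (ht : t.Prime) :
    ∃ Y : Subgroup G, Y.Normal ∧ ¬ t ∣ Nat.card Y ∧
      ∀ H : Subgroup G, H.Normal → ¬ t ∣ Nat.card H → H ≤ Y := by
  obtain ⟨Y, ⟨hYn, hYt⟩, hmax⟩ := Set.Finite.exists_maximal
    (Set.toFinite {Y : Subgroup G | Y.Normal ∧ ¬ t ∣ Nat.card Y})
    ⟨⊥, inferInstance, by simpa using ht.one_lt.ne'⟩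
  refine ⟨Y, hYn, hYt, fun H hHn hHt => ?_⟩
  refine le_trans le_sup_left (hmax (y := H ⊔ Y) ⟨inferInstance, fun hd => ?_⟩ le_sup_right)
  have := card_sup_mul_card_inf H Y
  rcases ht.dvd_mul.1 (this ▸ Dvd.dvd.mul_right hd _) with h | h
  · exact hHt h
  · exact hYt h

theorem hasPrimeSplittings_iSup [Finite G] :
    HasPrimeSplittings (⨆ H ∈ {H : Subgroup G | H.Normal ∧ Group.IsNilpotent ↥H}, H) := by
  intro t ht
  have : Fact t.Prime := ⟨ht⟩
  obtain ⟨Y₀, hY1, hY2, hY3⟩ := exists_greatest_normal_not_dvd G ht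
  set K₀ : Subgroup G := sSup {H : Subgroup G | H.Normal ∧ IsPGroup t H} with hK₀
  have hK1 : K₀.Normal := Subgroup.sSup_normal _ fun H hH => hH.1
  have hK2 : IsPGroup t K₀ := Sylow.sSup_of_normal _ (fun H hH => hH.2) (fun H hH => hH.1)
  have hK3 : ∀ H : Subgroup G, H.Normal → IsPGroup t H → H ≤ K₀ := fun H h1 h2 => le_sSup ⟨h1, h2⟩
  have hsplit : IsPrimeSplitting t (K₀ ⊔ Y₀) K₀ Y₀ := ⟨hK1, hY1, hK2, hY2, rfl⟩
  refine ⟨_, _, hsplit.inf ht (X := ⨆ H ∈ {H : Subgroup G | H.Normal ∧ Group.IsNilpotent ↥H}, H)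
    (hX := ?_) ?_⟩
  · rw [← sSup_eq_iSup]
    exact Subgroup.sSup_normal _ fun H hH => hH.1
  refine iSup₂_le fun H hH => ?_
  obtain ⟨hHn, hHnil⟩ := hH
  intro h hh
  by_contra hcon
  obtain ⟨q, j, hq, hj1, hj2⟩ := exists_isPElement_pow_notMem hcon
  apply hj2
  have : Fact q.Prime := ⟨hq⟩
  have hel : IsPElement q ((⟨h, hh⟩ : H) ^ j) := by
    obtain ⟨k, hk⟩ := hj1
    exact ⟨k, Subtype.ext (by simpa using hk)⟩
  obtain ⟨Q, hQ⟩ := hel.exists_mem_sylow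
  have hQc : (Q : Subgroup H).Characteristic := Q.characteristic_of_normal inferInstance
  have hQn : ((Q : Subgroup H).map H.subtype).Normal := ConjAct.normal_of_characteristic_of_normal
  have hmem : h ^ j ∈ (Q : Subgroup H).map H.subtype := ⟨_, hQ, by simp⟩
  have hQp : IsPGroup q ((Q : Subgroup H).map H.subtype) := Q.isPGroup'.map _
  by_cases hqt : q = t
  · subst hqt
    exact le_sup_left (a := K₀) (hK3 _ hQn hQp hmem)
  · refine le_sup_right (a := K₀) (hY3 _ hQn ?_ hmem)
    intro hd
    obtain ⟨n, hn⟩ := hQp.exists_card_eq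
    rw [hn] at hd
    exact hqt ((Nat.prime_dvd_prime_iff_eq ht hq).1 (ht.dvd_of_dvd_pow hd)).symm

theorem sylow_center_le_fitting_center [Finite G] {p : ℕ} (hp : p.Prime) {P F : Subgroup G}
    (hF : HasPrimeSplittings F) (hP : IsPGroup p P) (hPi : ¬ p ∣ P.index)
    (h : (Subgroup.center P).map P.subtype ≤ F) :
    (Subgroup.center P).map P.subtype ≤ (Subgroup.center F).map F.subtype := by
  have : Fact p.Prime := ⟨hp⟩
  obtain ⟨K, Y, hKY⟩ := hF p hp
  have := hKY.normal_left
  have hKP : K ≤ P := hKY.isPGroup.le_sylow_of_normal (hP.toSylow hPi)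
  rintro z hz
  have hzF := h hz
  obtain ⟨⟨z, hzP⟩, hzc, rfl⟩ := hz
  refine ⟨⟨z, hzF⟩, ?_, rfl⟩
  have hzK : z ∈ K := hKY.mem_left hp hzF (IsPElement.of_mem hP hzP)
  rw [SetLike.mem_coe, Subgroup.mem_center_iff]
  rintro ⟨g, hg⟩
  refine Subtype.ext ?_
  obtain ⟨k, hk, y, hy, rfl⟩ := hKY.exists_mul_eq hg
  have h1 : Commute k z := by
    have := Subgroup.mem_center_iff.1 hzc ⟨k, hKP hk⟩
    exact congrArg Subtype.val this
  exact h1.mul_left (hKY.commute hp hzK hy).symm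

end Splitting

section CoprimeAction

variable {G : Type*} [Group G]

theorem exists_normalizing_notMem {H P : Subgroup G} (hP : Group.IsNilpotent P) (hHP : H < P) :
    ∃ n ∈ P, n ∉ H ∧ ∀ h, h ∈ H ↔ n * h * n⁻¹ ∈ H := by
  have hlt : H.subgroupOf P < ⊤ := by
    rw [lt_top_iff_ne_top, Ne, Subgroup.subgroupOf_eq_top]
    exact hHP.not_ge
  have h1 := Group.normalizerCondition_of_isNilpotent (h := hP) _ hlt
  obtain ⟨n, hn1, hn2⟩ := SetLike.exists_of_lt h1
  refine ⟨n, n.2, hn2, fun h => ?_⟩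
  have h2 := Subgroup.mem_normalizer_iff.1 hn1
  constructor
  · intro hh
    exact (h2 ⟨h, hHP.le hh⟩).1 hh
  · intro hh
    have hhP : h ∈ P := by
      have := P.mul_mem (P.mul_mem (P.inv_mem n.2) (hHP.le hh)) n.2
      simpa [mul_assoc] using this
    exact (h2 ⟨h, hhP⟩).2 hh

theorem isNilpotent_of_isPGroup [Finite G] {r : ℕ} (hr : r.Prime) {P : Subgroup G}
    (hP : IsPGroup r P) : Group.IsNilpotent P :=
  have : Fact r.Prime := ⟨hr⟩
  hP.isNilpotent

/-- A coprime automorphism of an `r`-group `P` is trivial as soon as it centralizes the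
centralizer in `P` of its fixed points. -/
theorem commute_of_coprime_of_centralizer_fixed [Finite G] {r : ℕ} (hr : r.Prime) {P : Subgroup G}
    (hP : IsPGroup r P) {u : G} (hu : ∀ x ∈ P, u * x * u⁻¹ ∈ P) (hur : (orderOf u).Coprime r)
    (h : ∀ x ∈ P, (∀ y ∈ P, Commute u y → Commute x y) → Commute u x) :
    ∀ x ∈ P, Commute u x := by
  by_contra! hcon
  obtain ⟨x, hxP, hxu⟩ := hcon
  have hlt : P ⊓ cent u < P := lt_of_le_of_ne inf_le_left fun he =>
    hxu (mem_cent.1 (inf_eq_left.1 he hxP)).symm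
  obtain ⟨n, hnP, hn, hnorm⟩ := exists_normalizing_notMem (isNilpotent_of_isPGroup hr hP) hlt
  obtain ⟨k, hk⟩ : ∃ k, k = u * n * u⁻¹ * n⁻¹ := ⟨_, rfl⟩
  have hkP : k ∈ P := hk ▸ P.mul_mem (hu n hnP) (P.inv_mem hnP)
  have hku : Commute u k := by
    refine h k hkP fun y hy huy => ?_
    have h1 : n⁻¹ * y * n ∈ P ⊓ cent u := by
      rw [hnorm]
      have : n * (n⁻¹ * y * n) * n⁻¹ = y := by group
      rw [this]
      exact ⟨hy, mem_cent.2 huy.symm⟩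
    have h2 : u⁻¹ * (n⁻¹ * y * n) = (n⁻¹ * y * n) * u⁻¹ := (mem_cent.1 h1.2).symm.inv_left
    have h3 : k * y = u * n * (u⁻¹ * (n⁻¹ * y * n)) * n⁻¹ := by rw [hk]; group
    have h4 : u * y = y * u := huy
    change k * y = y * k
    rw [h3, h2, hk]
    calc u * n * (n⁻¹ * y * n * u⁻¹) * n⁻¹ = u * y * n * u⁻¹ * n⁻¹ := by group
      _ = _ := by rw [h4]; group
  have hpow : ∀ m : ℕ, u ^ m * n * (u ^ m)⁻¹ = k ^ m * n := by
    intro m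
    induction m with
    | zero => simp
    | succ m ih =>
      have h1 : u ^ (m + 1) * n * (u ^ (m + 1))⁻¹ = u * (u ^ m * n * (u ^ m)⁻¹) * u⁻¹ := by
        rw [pow_succ']; group
      have h2 : u * k ^ m = k ^ m * u := hku.pow_right m
      rw [h1, ih, ← mul_assoc, h2, pow_succ]
      have h3 : u * n = k * n * u := by rw [hk]; group
      calc k ^ m * u * n * u⁻¹ = k ^ m * (u * n) * u⁻¹ := by group
        _ = _ := by rw [h3]; group
  have h1 : k ^ orderOf u = 1 := by
    have := hpow (orderOf u)
    rw [pow_orderOf_eq_one] at this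
    simpa using this.symm
  have hk1 : k = 1 := by
    refine (IsPElement.of_mem hP hkP).eq_one_of_coprime ?_
    exact Nat.Coprime.coprime_dvd_left (orderOf_dvd_of_pow_eq_one h1) hur
  refine hn ⟨hnP, mem_cent.2 ?_⟩
  rw [hk1] at hk
  change n * u = u * n
  have h5 : u * n = u * n * u⁻¹ * n⁻¹ * n * u := by group
  rw [h5, ← hk, one_mul]

theorem mul_pow_eq_of_conj_mem {H : Subgroup G} {w m : G} (hw : w ∈ H)
    (hm : ∀ h ∈ H, m * h * m⁻¹ ∈ H) (k : ℕ) : ∃ h ∈ H, (w * m) ^ k = h * m ^ k := by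
  have hm' : ∀ k : ℕ, ∀ h ∈ H, m ^ k * h * (m ^ k)⁻¹ ∈ H := by
    intro k
    induction k with
    | zero => simp
    | succ k ih =>
      intro h hh
      have := hm _ (ih h hh)
      rw [pow_succ']
      convert this using 1
      group
  induction k with
  | zero => exact ⟨1, H.one_mem, by simp⟩
  | succ k ih =>
    obtain ⟨h, hh, hk⟩ := ih
    refine ⟨h * (m ^ k * w * (m ^ k)⁻¹), H.mul_mem hh (hm' k w hw), ?_⟩
    rw [pow_succ, hk, pow_succ]; group

theorem mul_pow_mem_iff {N : Subgroup G} [N.Normal] {w m : G} (hm : m ∈ N) (k : ℕ) :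
    (w * m) ^ k ∈ N ↔ w ^ k ∈ N := by
  rw [← QuotientGroup.eq_one_iff, ← QuotientGroup.eq_one_iff (N := N) (w ^ k),
    QuotientGroup.mk_pow, QuotientGroup.mk_pow, QuotientGroup.mk_mul,
    (QuotientGroup.eq_one_iff m).2 hm, mul_one]

variable [Finite G] {N : Subgroup G} {c : ℕ}

theorem cent_pow_eq (hc : ∀ g ∉ N, Nat.card (cent g) = c) {g : G} {n : ℕ} (h : g ^ n ∉ N) :
    cent (g ^ n) = cent g := by
  have hg : g ∉ N := fun hg => h (N.pow_mem hg n)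
  refine (Subgroup.eq_of_le_of_card_ge (cent_le_cent_pow g n) ?_).symm
  rw [hc g hg, hc _ h]

theorem cent_le_cent_of_coprime (hc : ∀ g ∉ N, Nat.card (cent g) = c) {u v : G} (hu : u ∉ N)
    (huv : Commute u v) (hcop : (orderOf u).Coprime (orderOf v)) : cent u ≤ cent v := by
  obtain ⟨a, ha1, ha2⟩ := Nat.chineseRemainder hcop 1 0
  have h1 : (u * v) ^ a = u := by
    rw [huv.mul_pow, orderOf_dvd_iff_pow_eq_one.1 ((Nat.modEq_zero_iff_dvd).1 ha2), mul_one]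
    simpa using pow_eq_pow_iff_modEq.2 ha1
  have h2 := cent_pow_eq hc (g := u * v) (n := a) (by rwa [h1])
  rw [h1] at h2
  rw [h2]
  exact fun x hx => ((commute_mul_iff_of_coprime huv hcop).1 hx).2

theorem cent_eq_cent_of_coprime (hc : ∀ g ∉ N, Nat.card (cent g) = c) {u v : G} (hu : u ∉ N)
    (hv : v ∉ N) (huv : Commute u v) (hcop : (orderOf u).Coprime (orderOf v)) :
    cent u = cent v :=
  le_antisymm (cent_le_cent_of_coprime hc hu huv hcop)
    (cent_le_cent_of_coprime hc hv huv.symm hcop.symm)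

theorem le_cent_of_cent_eq {r : ℕ} (hr : r.Prime) {K : Subgroup G} [hKn : K.Normal]
    (hK : IsPGroup r K) {u v : G} (hur : (orderOf u).Coprime r) (hv : IsPElement r v)
    (h : cent u = cent v) : K ≤ cent u := by
  have huv : Commute u v := mem_cent.1 (h ▸ self_mem_cent u)
  have key := commute_of_coprime_of_centralizer_fixed hr (isPGroup_sup_zpowers hK hv) (u := u) ?_
    hur ?_
  · exact fun x hx => mem_cent.2 (key x (Subgroup.mem_sup_left hx)).symm
  · intro x hx
    obtain ⟨k, hk, z, hz, rfl⟩ := Subgroup.mem_sup_of_normal_left.1 hx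
    obtain ⟨i, rfl⟩ := Subgroup.mem_zpowers_iff.1 hz
    have h1 : u * v ^ i = v ^ i * u := huv.zpow_right i
    have : u * (k * v ^ i) * u⁻¹ = u * k * u⁻¹ * v ^ i := by
      calc _ = u * k * u⁻¹ * (u * v ^ i) * u⁻¹ := by group
        _ = _ := by rw [h1]; group
    rw [this]
    exact Subgroup.mul_mem_sup (hKn.conj_mem k hk u) hz
  · intro x _ hx
    have h1 : x ∈ cent v := mem_cent.2 (hx v (Subgroup.mem_sup_right (Subgroup.mem_zpowers v)) huv)
    rw [← h] at h1
    exact (mem_cent.1 h1).symm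

theorem exists_isPElement_mem_cent (hc : ∀ g ∉ N, Nat.card (cent g) = c) {r : ℕ} (hr : r.Prime)
    {K Y : Subgroup G} (hN : IsPrimeSplitting r N K Y) {v : G} (hv : v ∉ N) (hvr : IsPElement r v)
    (hKv : K ≤ cent v) {g : G} (hg : g ∉ N) : ∃ w ∈ cent g, IsPElement r w ∧ w ∉ N := by
  have := hN.normal_left
  have : Fact r.Prime := ⟨hr⟩
  by_contra! hcon
  have hP := isPGroup_sup_zpowers hN.isPGroup hvr
  obtain ⟨n, hn⟩ := hP.exists_card_eq
  have hle : K ⊔ Subgroup.zpowers v ≤ cent v :=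
    sup_le hKv (by rw [Subgroup.zpowers_le]; exact self_mem_cent v)
  have hdvd : r ^ n ∣ Nat.card (cent g) := by
    rw [hc g hg, ← hc v hv, ← hn]; exact Subgroup.card_dvd_of_le hle
  obtain ⟨Q, hQ⟩ := Sylow.exists_subgroup_card_pow_prime r hdvd
  have hQ' : IsPGroup r (Q.map (cent g).subtype) := (IsPGroup.of_card hQ).map _
  have hQN : Q.map (cent g).subtype ≤ N := by
    intro x hx
    refine hcon x ?_ (IsPElement.of_mem hQ' hx)
    obtain ⟨y, -, rfl⟩ := hx
    exact y.2
  have hQK := hN.le_left hr hQN hQ'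
  have hcard : Nat.card (Q.map (cent g).subtype) = r ^ n := by
    rw [← hQ]
    exact Subgroup.card_map_of_injective (Subgroup.subtype_injective _)
  have h1 : K = K ⊔ Subgroup.zpowers v := by
    refine Subgroup.eq_of_le_of_card_ge le_sup_left ?_
    rw [hn, ← hcard]
    exact Subgroup.card_le_of_le hQK
  apply hv
  apply hN.left_le
  rw [h1]
  exact Subgroup.mem_sup_right (Subgroup.mem_zpowers v)

theorem le_cent_of_pow_notMem [N.Normal] (hc : ∀ g ∉ N, Nat.card (cent g) = c) {r : ℕ}
    (hr : r.Prime) {K : Subgroup G} [hKn : K.Normal] (hK : IsPGroup r K) (hKN : K ≤ N)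
    {w : G} (hw : IsPElement r w) (hwr : w ^ r ∉ N) : K ≤ cent w := by
  have hP := isPGroup_sup_zpowers hK hw
  set P := K ⊔ Subgroup.zpowers w with hPdef
  have hwP : w ∈ P := Subgroup.mem_sup_right (Subgroup.mem_zpowers w)
  by_contra hcon
  have hlt : P ⊓ cent w < P := lt_of_le_of_ne inf_le_left fun he =>
    hcon (le_sup_left.trans (inf_eq_left.1 he))
  obtain ⟨n, hnP, hn, hnorm⟩ := exists_normalizing_notMem (isNilpotent_of_isPGroup hr hP) hlt
  obtain ⟨m₀, hm₀, z, hz, rfl⟩ := Subgroup.mem_sup_of_normal_left.1 hnP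
  obtain ⟨i, rfl⟩ := Subgroup.mem_zpowers_iff.1 hz
  have hwH : w ∈ P ⊓ cent w := ⟨hwP, self_mem_cent w⟩
  have hm₀w : m₀ ∉ cent w := fun h => hn ⟨hnP, (cent w).mul_mem h
    ((cent w).zpow_mem (self_mem_cent w) i)⟩
  have hm₀H : ∀ h ∈ P ⊓ cent w, m₀ * h * m₀⁻¹ ∈ P ⊓ cent w := by
    intro h hh
    have h1 := (hnorm h).1 hh
    have h2 : w ^ i * h = h * w ^ i := (mem_cent.1 hh.2).symm.zpow_left i
    have h3 : m₀ * w ^ i * h * (m₀ * w ^ i)⁻¹ = m₀ * h * m₀⁻¹ := by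
      calc _ = m₀ * (w ^ i * h) * (w ^ i)⁻¹ * m₀⁻¹ := by group
        _ = _ := by rw [h2]; group
    rwa [h3] at h1
  have hpowH : ∀ k : ℕ, ∀ h ∈ P ⊓ cent w, m₀ ^ k * h * (m₀ ^ k)⁻¹ ∈ P ⊓ cent w := by
    intro k
    induction k with
    | zero => intro h hh; simpa using hh
    | succ k ih =>
      intro h hh
      have := hm₀H _ (ih h hh)
      rw [pow_succ']
      convert this using 1
      group
  have hex : ∃ j, m₀ ^ r ^ j ∈ cent w := by
    obtain ⟨j, hj⟩ := IsPElement.of_mem hK hm₀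
    exact ⟨j, hj ▸ (cent w).one_mem⟩
  obtain ⟨j, hj1, hj2⟩ : ∃ j, m₀ ^ r ^ j ∉ cent w ∧ m₀ ^ r ^ (j + 1) ∈ cent w := by
    have h0 : Nat.find hex ≠ 0 := fun h0 => by
      have := Nat.find_spec hex
      rw [h0] at this
      exact hm₀w (by simpa using this)
    obtain ⟨j, hj⟩ := Nat.exists_eq_succ_of_ne_zero h0
    refine ⟨j, Nat.find_min hex (by omega), ?_⟩
    have := Nat.find_spec hex
    rwa [hj] at this
  set m := m₀ ^ r ^ j with hm
  have hmr : m ^ r ∈ cent w := by rw [hm, ← pow_mul, ← pow_succ]; exact hj2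
  obtain ⟨h, hh, hpow⟩ := mul_pow_eq_of_conj_mem hwH (hpowH (r ^ j)) r
  have h1 : (w * m) ^ r ∈ cent w := by
    rw [hpow]
    exact (cent w).mul_mem hh.2 hmr
  have h2 : (w * m) ^ r ∉ N := by
    rwa [mul_pow_mem_iff (hKN (K.pow_mem hm₀ _))]
  have h3 := cent_pow_eq hc h2
  have h4 : w ∈ cent (w * m) := h3 ▸ mem_cent_comm.1 h1
  apply hj1
  have h5 : w * m ∈ cent w := mem_cent_comm.1 h4
  have := (cent w).mul_mem ((cent w).inv_mem (self_mem_cent w)) h5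
  rwa [inv_mul_cancel_left] at this

end CoprimeAction

section Partition

theorem sum_pow_mul_eq_sum_pow {R : Type*} [Ring R] {r : ℕ} (hr : r.Prime) {ψ : R}
    (hψ : ψ ^ r = 1) {j : ℕ} (hj : ¬ r ∣ j) :
    ∑ i ∈ Finset.range r, ψ ^ (i * j) = ∑ i ∈ Finset.range r, ψ ^ i := by
  have hcop : r.gcd j = 1 := hr.coprime_iff_not_dvd.2 hj
  have hmaps : Set.MapsTo (fun i => i * j % r) (Finset.range r : Set ℕ) (Finset.range r) := by
    intro i _
    simpa using Nat.mod_lt _ hr.pos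
  have hinj : Set.InjOn (fun i => i * j % r) (Finset.range r : Set ℕ) := by
    intro a ha b hb hab
    have h1 : a ≡ b [MOD r] := Nat.ModEq.cancel_right_of_coprime hcop hab
    simp only [Finset.coe_range, Set.mem_Iio] at ha hb
    exact Nat.ModEq.eq_of_lt_of_lt h1 ha hb
  refine Finset.sum_nbij (fun i => i * j % r) hmaps hinj
    (Finset.surjOn_of_injOn_of_card_le _ hmaps hinj le_rfl) fun i _ => ?_
  conv_lhs => rw [← Nat.div_add_mod (i * j) r, pow_add, pow_mul, hψ, one_pow, one_mul]

theorem natCast_eq_zero_of_sum_pow_eq_zero {R : Type*} [Ring R] {r : ℕ} (hr : r.Prime) {φ ψ : R}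
    (hc : Commute φ ψ) (hψ : ψ ^ r = 1)
    (h₁ : ∀ i < r, ∑ j ∈ Finset.range r, (φ * ψ ^ i) ^ j = 0)
    (h₂ : ∑ j ∈ Finset.range r, ψ ^ j = 0) : (r : R) = 0 := by
  have h3 : ∑ i ∈ Finset.range r, ∑ j ∈ Finset.range r, (φ * ψ ^ i) ^ j = 0 :=
    Finset.sum_eq_zero fun i hi => h₁ i (Finset.mem_range.1 hi)
  rw [Finset.sum_comm] at h3
  obtain ⟨n, rfl⟩ : ∃ n, r = n + 1 := ⟨r - 1, by have := hr.pos; omega⟩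
  rw [Finset.sum_range_succ'] at h3
  rw [Finset.sum_eq_zero, zero_add] at h3
  · simpa using h3
  · intro j hj
    have h4 : ¬ (n + 1) ∣ (j + 1) := fun hd => by
      have := Nat.le_of_dvd (Nat.succ_pos j) hd
      have := Finset.mem_range.1 hj
      omega
    have h5 := sum_pow_mul_eq_sum_pow hr hψ h4
    calc ∑ i ∈ Finset.range (n + 1), (φ * ψ ^ i) ^ (j + 1)
        = ∑ i ∈ Finset.range (n + 1), φ ^ (j + 1) * ψ ^ (i * (j + 1)) := by
          refine Finset.sum_congr rfl fun i _ => ?_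
          rw [(hc.pow_right i).mul_pow, pow_mul]
      _ = 0 := by rw [← Finset.mul_sum, h5, h₂, mul_zero]

theorem pow_prime_eq_one_of_norms_trivial {G : Type*} [Group G] {A : Subgroup G} [hAn : A.Normal]
    (hA : ∀ a ∈ A, ∀ b ∈ A, Commute a b) {r : ℕ} (hr : r.Prime) {n₁ n₂ : G}
    (hcomm : ∀ a ∈ A, n₁ * n₂ * a * (n₁ * n₂)⁻¹ = n₂ * n₁ * a * (n₂ * n₁)⁻¹)
    (hn₂ : ∀ a ∈ A, Commute (n₂ ^ r) a)
    (h₁ : ∀ i < r, ∀ a ∈ A, (a * (n₁ * n₂ ^ i)) ^ r = (n₁ * n₂ ^ i) ^ r)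
    (h₂ : ∀ a ∈ A, (a * n₂) ^ r = n₂ ^ r) : ∀ a ∈ A, a ^ r = 1 := by
  let _ : CommGroup A :=
    { (inferInstance : Group A) with mul_comm := fun a b => Subtype.ext (hA a a.2 b b.2) }
  have hext : ∀ f g : AddMonoid.End (Additive A),
      (∀ a : A, ((f (Additive.ofMul a)).toMul : G) = (g (Additive.ofMul a)).toMul) → f = g :=
    fun f g h => DFunLike.ext _ _ fun a => Additive.toMul.injective (Subtype.ext (h a.toMul))
  let ρ : G →* AddMonoid.End (Additive A) :=
    { toFun := fun g =>
        { toFun := fun a => Additive.ofMul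
            (⟨g * (a.toMul : A) * g⁻¹, hAn.conj_mem _ (a.toMul).2 g⟩ : A)
          map_zero' := by
            apply Additive.toMul.injective
            exact Subtype.ext (by simp)
          map_add' := fun a b => by
            apply Additive.toMul.injective
            exact Subtype.ext (by simp) }
      map_one' := by
        refine hext _ _ fun a => ?_
        change 1 * (a : G) * 1⁻¹ = a
        simp
      map_mul' := fun g h => by
        refine hext _ _ fun a => ?_
        change g * h * (a : G) * (g * h)⁻¹ = g * (h * a * h⁻¹) * g⁻¹
        group }
  have hpow : ∀ (n : G) (a : A) (k : ℕ), ((a : G) * n) ^ k =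
      (((∑ j ∈ Finset.range k, (ρ n) ^ j) (Additive.ofMul a)).toMul : A) * n ^ k := by
    intro n a k
    induction k with
    | zero => simp
    | succ k ih =>
      rw [pow_succ, ih, Finset.sum_range_succ, ← map_pow]
      have : (((∑ j ∈ Finset.range k, (ρ n) ^ j + ρ (n ^ k)) (Additive.ofMul a)).toMul : G) =
        (((∑ j ∈ Finset.range k, (ρ n) ^ j) (Additive.ofMul a)).toMul : A) *
          (n ^ k * a * (n ^ k)⁻¹) := rfl
      rw [this, pow_succ]
      group
  have hsum : ∀ n : G, (∀ a ∈ A, (a * n) ^ r = n ^ r) → ∑ j ∈ Finset.range r, (ρ n) ^ j = 0 := by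
    intro n hn
    refine hext _ _ fun a => ?_
    have h1 := hpow n a r
    rw [hn _ a.2] at h1
    exact right_eq_mul.1 h1
  have key : ((r : ℕ) : AddMonoid.End (Additive A)) = 0 := by
    refine natCast_eq_zero_of_sum_pow_eq_zero hr (φ := ρ n₁) (ψ := ρ n₂) ?_ ?_ ?_ (hsum n₂ h₂)
    · change ρ n₁ * ρ n₂ = ρ n₂ * ρ n₁
      rw [← map_mul, ← map_mul]
      exact hext _ _ fun a => hcomm _ a.2
    · rw [← map_pow]
      refine hext _ _ fun a => ?_
      change n₂ ^ r * (a : G) * (n₂ ^ r)⁻¹ = a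
      rw [(hn₂ _ a.2).eq]; group
    · intro i hi
      rw [← map_pow, ← map_mul]
      exact hsum _ (h₁ i hi)
  intro a ha
  have h1 := congrArg (fun f : AddMonoid.End (Additive A) => f (Additive.ofMul ⟨a, ha⟩)) key
  simp only [AddMonoid.End.natCast_apply] at h1
  have h2 : (⟨a, ha⟩ : A) ^ r = 1 := h1
  simpa using congrArg Subtype.val h2

end Partition

section Abelian

theorem exists_prime_noncyclic_pair {A : Type*} [Group A] [Finite A]
    (hA : ∀ a b : A, Commute a b) (h : ¬ IsCyclic A) :
    ∃ t : ℕ, t.Prime ∧ ∃ x y : A, x ^ t = 1 ∧ y ^ t = 1 ∧ y ≠ 1 ∧ ∀ i : ℕ, x * y ^ i ≠ 1 := by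
  let _ : CommGroup A := { (inferInstance : Group A) with mul_comm := fun a b => hA a b }
  obtain ⟨g, hg⟩ := Monoid.exists_orderOf_eq_exponent
    (Monoid.ExponentExists.of_finite (G := A))
  set e := Monoid.exponent A with he
  have hepos : 0 < e := hg ▸ orderOf_pos g
  have hne : Subgroup.zpowers g ≠ ⊤ := fun ht => h ⟨g, fun x => by
    have : x ∈ (⊤ : Subgroup A) := Subgroup.mem_top x
    rwa [← ht] at this⟩
  have hnt : Nat.card (A ⧸ Subgroup.zpowers g) ≠ 1 := by
    rw [← Subgroup.index_eq_card]
    exact fun h1 => hne (Subgroup.index_eq_one.1 h1)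
  obtain ⟨t, ht, htd⟩ := Nat.exists_prime_and_dvd hnt
  have : Fact t.Prime := ⟨ht⟩
  obtain ⟨h', hh'⟩ := exists_prime_orderOf_dvd_card' t htd
  obtain ⟨k, rfl⟩ := QuotientGroup.mk_surjective h'
  have hkt : k ^ t ∈ Subgroup.zpowers g := by
    rw [← QuotientGroup.eq_one_iff, QuotientGroup.mk_pow, ← hh', pow_orderOf_eq_one]
  have hk : k ∉ Subgroup.zpowers g := by
    rw [← QuotientGroup.eq_one_iff, ← orderOf_eq_one_iff, hh']
    exact ht.one_lt.ne'
  have hte : t ∣ e := by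
    rw [← hh']
    refine orderOf_dvd_of_pow_eq_one ?_
    rw [← QuotientGroup.mk_pow, Monoid.pow_exponent_eq_one]; rfl
  obtain ⟨d, hd⟩ := hte
  have hdpos : 0 < d := Nat.pos_of_ne_zero fun h0 => by rw [h0] at hd; omega
  obtain ⟨j, hj⟩ := mem_powers_iff_mem_zpowers.2 hkt
  have hj' : g ^ j = k ^ t := hj
  have h1 : g ^ (j * d) = 1 := by
    rw [pow_mul, hj', ← pow_mul, ← hd, Monoid.pow_exponent_eq_one]
  have h2 : t * d ∣ j * d := by
    rw [← hd, ← hg]; exact orderOf_dvd_of_pow_eq_one h1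
  obtain ⟨j', rfl⟩ := Nat.dvd_of_mul_dvd_mul_right hdpos h2
  refine ⟨t, ht, k * (g ^ j')⁻¹, g ^ d, ?_, ?_, ?_, ?_⟩
  · rw [mul_pow, inv_pow, ← pow_mul, mul_comm j', hj']
    simp
  · rw [← pow_mul, mul_comm, ← hd, Monoid.pow_exponent_eq_one]
  · intro h1
    have h3 := orderOf_dvd_of_pow_eq_one h1
    rw [hg, hd] at h3
    have := Nat.le_of_dvd hdpos h3
    have := ht.two_le
    nlinarith
  · intro i hi
    apply hk
    have : k = ((g ^ d) ^ i)⁻¹ * g ^ j' := by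
      have := eq_inv_of_mul_eq_one_left hi
      rw [← this]; group
    rw [this]
    exact Subgroup.mul_mem _ (Subgroup.inv_mem _ (Subgroup.pow_mem _ (Subgroup.pow_mem _
      (Subgroup.mem_zpowers g) _) _)) (Subgroup.pow_mem _ (Subgroup.mem_zpowers g) _)

end Abelian

section FixedPoints

variable {G : Type*} [Group G] [Finite G]

theorem mul_pow_prime_eq_of_fixed_le {r : ℕ} (hr : r.Prime) {Y B : Subgroup G} [hBn : B.Normal]
    (hBY : B ≤ Y) (hYr : ¬ r ∣ Nat.card Y) {n : G} (hn : ∀ y ∈ Y, Commute (n ^ r) y)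
    (hB : ∀ y ∈ Y, y ∈ B ↔ Commute y n) {A : Subgroup (G ⧸ B)} [hAn : A.Normal]
    (hA : ∀ a ∈ A, ∀ b ∈ A, Commute a b) (hAY : A ≤ Y.map (QuotientGroup.mk' B)) :
    ∀ v ∈ A, (v * (n : G ⧸ B)) ^ r = (n : G ⧸ B) ^ r := by
  intro v hv
  obtain ⟨h, hhA, hh⟩ := mul_pow_eq_of_conj_mem hv
    (fun x hx => hAn.conj_mem x hx (n : G ⧸ B)) r
  have hcom : ∀ x ∈ A, Commute ((n : G ⧸ B) ^ r) x := by
    intro x hx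
    obtain ⟨y, hy, rfl⟩ := hAY hx
    exact (hn y hy).map (QuotientGroup.mk' B)
  have h1 : Commute h (v * (n : G ⧸ B)) := by
    have e : h = (v * (n : G ⧸ B)) ^ r * ((n : G ⧸ B) ^ r)⁻¹ := by rw [hh]; group
    rw [e]
    refine Commute.mul_left (Commute.pow_self _ _) (Commute.inv_left ?_)
    exact Commute.mul_right (hcom v hv) (Commute.pow_self _ _)
  have h2 : Commute h (n : G ⧸ B) := by
    have := ((hA h hhA v hv).inv_right).mul_right h1
    rwa [inv_mul_cancel_left] at this
  obtain ⟨y, hy, rfl⟩ := hAY hhA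
  obtain ⟨β, hβ⟩ : ∃ β, β = y⁻¹ * (n * y * n⁻¹) := ⟨_, rfl⟩
  have hβB : β ∈ B := by
    rw [← QuotientGroup.eq_one_iff, hβ]
    have h3 : (n : G ⧸ B) * (y : G ⧸ B) = (y : G ⧸ B) * (n : G ⧸ B) := h2.symm
    rw [QuotientGroup.mk_mul, QuotientGroup.mk_mul, QuotientGroup.mk_mul, h3]
    simp
  have hβn : n * β = β * n := ((hB β (hBY hβB)).1 hβB).symm
  have hpow : ∀ k : ℕ, n ^ k * y * (n ^ k)⁻¹ = y * β ^ k := by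
    intro k
    induction k with
    | zero => simp
    | succ k ih =>
      have h3 : n ^ (k + 1) * y * (n ^ (k + 1))⁻¹ = n * (n ^ k * y * (n ^ k)⁻¹) * n⁻¹ := by
        rw [pow_succ']; group
      have h4 : n * β ^ k = β ^ k * n := (Commute.pow_right hβn k)
      rw [h3, ih]
      calc n * (y * β ^ k) * n⁻¹ = n * y * n⁻¹ * (n * β ^ k) * n⁻¹ := by group
        _ = y * (y⁻¹ * (n * y * n⁻¹)) * β ^ k := by rw [h4]; group
        _ = _ := by rw [← hβ, pow_succ']; group
  have hβ1 : β ^ r = 1 := by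
    have h3 := hpow r
    rw [(hn y hy).eq, mul_inv_cancel_right] at h3
    exact left_eq_mul.1 h3
  have hβ2 : β = 1 :=
    isPElement_of_not_dvd_eq_one hr hYr (hBY hβB) (isPElement_of_pow_prime_eq_one hβ1)
  have hyB : y ∈ B := by
    rw [hB y hy]
    have h3 := hpow 1
    rw [hβ2, pow_one, one_pow, mul_one, mul_inv_eq_iff_eq_mul] at h3
    exact h3.symm
  have : (QuotientGroup.mk' B) y = 1 := (QuotientGroup.eq_one_iff y).2 hyB
  rw [hh, this, one_mul]

theorem not_lt_of_common_fixedPoints_of_normal {r : ℕ} (hr : r.Prime) {Y B : Subgroup G}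
    [hYn : Y.Normal] [hBn : B.Normal] (hY : Group.IsNilpotent Y) (hYr : ¬ r ∣ Nat.card Y)
    {a b : G} (hab : Commute a b) (ha : ∀ y ∈ Y, Commute (a ^ r) y)
    (hb : ∀ y ∈ Y, Commute (b ^ r) y) (hBb : ∀ y ∈ Y, y ∈ B ↔ Commute y b)
    (hBi : ∀ i < r, ∀ y ∈ Y, y ∈ B ↔ Commute y (a * b ^ i)) : ¬ B < Y := by
  intro hBY
  set π := QuotientGroup.mk' B with hπ
  set Y' := Y.map π with hY'
  have hY'n : Y'.Normal := hYn.map π (QuotientGroup.mk'_surjective B)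
  have hY'nil : Group.IsNilpotent Y' :=
    Group.nilpotent_of_surjective (π.subgroupMap Y) (π.subgroupMap_surjective Y)
  have hnt : Nontrivial Y' := by
    rw [Subgroup.nontrivial_iff_ne_bot]
    intro hbot
    rw [hY', Subgroup.map_eq_bot_iff, hπ, QuotientGroup.ker_mk'] at hbot
    exact hBY.not_ge hbot
  set A := (Subgroup.center Y').map Y'.subtype with hA
  have hAn : A.Normal := ConjAct.normal_of_characteristic_of_normal
  have hAY : A ≤ Y' := by rintro _ ⟨x, -, rfl⟩; exact x.2
  have hAc : ∀ x ∈ A, ∀ y ∈ Y', Commute y x := by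
    rintro _ ⟨x, hx, rfl⟩ y hy
    exact congrArg Subtype.val (Subgroup.mem_center_iff.1 hx ⟨y, hy⟩)
  have hAA : ∀ x ∈ A, ∀ y ∈ A, Commute x y := fun x hx y hy => hAc y hy x (hAY hx)
  have hexp : ∀ v ∈ A, v ^ r = 1 := by
    refine pow_prime_eq_one_of_norms_trivial hAA hr (n₁ := (a : G ⧸ B)) (n₂ := (b : G ⧸ B))
      ?_ ?_ ?_ ?_
    · intro x _
      have : (a : G ⧸ B) * (b : G ⧸ B) = (b : G ⧸ B) * (a : G ⧸ B) := hab.map π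
      rw [this]
    · intro x hx
      obtain ⟨y, hy, rfl⟩ := hAY hx
      exact (hb y hy).map π
    · intro i hi
      refine mul_pow_prime_eq_of_fixed_le hr hBY.le hYr (n := a * b ^ i) ?_ (hBi i hi) hAA hAY
      intro y hy
      rw [(hab.pow_right i).mul_pow, ← pow_mul, mul_comm i, pow_mul]
      exact (ha y hy).mul_left ((hb y hy).pow_left i)
    · exact mul_pow_prime_eq_of_fixed_le hr hBY.le hYr hb hBb hAA hAY
  obtain ⟨⟨z, hz⟩, hz1⟩ := Subgroup.ne_bot_iff_exists_ne_one.1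
    (Group.IsNilpotent.center_ne_bot (G := Y'))
  have hzA : ((z : Y') : G ⧸ B) ∈ A := ⟨z, hz, rfl⟩
  have hdvd : ¬ r ∣ Nat.card Y' := fun hd => hYr (hd.trans (Subgroup.card_map_dvd Y π))
  have := isPElement_of_not_dvd_eq_one hr hdvd (hAY hzA)
    (isPElement_of_pow_prime_eq_one (hexp _ hzA))
  exact hz1 (Subtype.ext (Subtype.ext this))

theorem le_cent_of_common_fixedPoints {r : ℕ} (hr : r.Prime) {Y : Subgroup G}
    [hYn : Y.Normal] (hY : Group.IsNilpotent Y) (hYr : ¬ r ∣ Nat.card Y)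
    {a b : G} (hab : Commute a b) (ha : ∀ y ∈ Y, Commute (a ^ r) y)
    (hb : ∀ y ∈ Y, Commute (b ^ r) y)
    (h : ∀ i < r, ∀ y ∈ Y, Commute y (a * b ^ i) ↔ Commute y b) : Y ≤ cent b := by
  by_contra hcon
  set B := Y ⊓ cent b with hB
  have hlt : B < Y := lt_of_le_of_ne inf_le_left fun he => hcon (inf_eq_left.1 he)
  obtain ⟨m, hmY, hmB, hm⟩ := exists_normalizing_notMem hY hlt
  set U := Subgroup.normalizer (B : Set G) with hU
  have hBU : B ≤ U := Subgroup.le_normalizer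
  have hcentU : ∀ g, Commute g b → g ∈ U := by
    intro g hg
    have hcen : ∀ x, g * x * g⁻¹ ∈ cent b ↔ x ∈ cent b := fun x => by
      have h1 : g * b * g⁻¹ = b := by rw [hg.eq, mul_inv_cancel_right]
      conv_lhs => rw [← h1]
      exact conj_mem_cent g
    rw [hU, Subgroup.mem_normalizer_iff]
    intro x
    rw [hB, Subgroup.mem_inf, Subgroup.mem_inf, hcen, hYn.mem_comm_iff, inv_mul_cancel_left]
  have haU := hcentU a hab
  have hbU := hcentU b (Commute.refl b)
  have hmU : m ∈ U := Subgroup.mem_normalizer_iff.2 hm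
  have hYnil : Group.IsNilpotent (Y.subgroupOf U) := by
    have h1 : Group.IsNilpotent ↥(Y ⊓ U) := isNilpotent_of_le hY inf_le_left
    have h2 := (Group.isNilpotent_congr (Subgroup.subgroupOfEquivOfLe
      (inf_le_right : Y ⊓ U ≤ U))).2 h1
    rwa [Subgroup.inf_subgroupOf_right] at h2
  have hcard : ¬ r ∣ Nat.card (Y.subgroupOf U) := by
    intro hd
    apply hYr
    refine hd.trans ?_
    rw [← Subgroup.inf_subgroupOf_right, Nat.card_congr (Subgroup.subgroupOfEquivOfLe
      (inf_le_right : Y ⊓ U ≤ U)).toEquiv]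
    exact Subgroup.card_dvd_of_le inf_le_left
  have hcomm : ∀ x y : U, Commute x y ↔ Commute (x : G) y := fun x y =>
    ⟨fun hxy => congrArg Subtype.val hxy, fun hxy => Subtype.ext hxy⟩
  have hBn : (B.subgroupOf U).Normal := Subgroup.normal_in_normalizer
  refine not_lt_of_common_fixedPoints_of_normal hr (Y := Y.subgroupOf U) (B := B.subgroupOf U)
    hYnil hcard (a := ⟨a, haU⟩) (b := ⟨b, hbU⟩) ((hcomm _ _).2 hab) ?_ ?_ ?_ ?_ ?_
  · exact fun y hy => (hcomm _ _).2 (ha y hy)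
  · exact fun y hy => (hcomm _ _).2 (hb y hy)
  · intro y hy
    rw [hcomm]
    exact ⟨fun hyB => mem_cent.1 hyB.2, fun hyb => ⟨hy, mem_cent.2 hyb⟩⟩
  · intro i hi y hy
    rw [hcomm]
    refine Iff.trans ?_ (h i hi y hy).symm
    exact ⟨fun hyB => mem_cent.1 hyB.2, fun hyb => ⟨hy, mem_cent.2 hyb⟩⟩
  · refine lt_of_le_of_ne (fun x hx => hx.1) fun he => hmB ?_
    have : (⟨m, hmU⟩ : U) ∈ Y.subgroupOf U := hmY
    rw [← he] at this
    exact this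

theorem right_le_cent_of_cent_mul_pow_eq {t : ℕ} (ht : t.Prime) {N K Y : Subgroup G}
    (hN : IsPrimeSplitting t N K Y) (hY : Group.IsNilpotent Y) {a b : G} (hab : Commute a b)
    (ha : a ^ t ∈ K) (hb : b ^ t ∈ K) (h : ∀ i : ℕ, cent (a * b ^ i) = cent b) : Y ≤ cent b := by
  have := hN.normal_right
  refine le_cent_of_common_fixedPoints ht hY hN.not_dvd hab
    (fun y hy => hN.commute ht ha hy) (fun y hy => hN.commute ht hb hy) fun i _ y _ => ?_
  rw [← mem_cent, h, mem_cent]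

end FixedPoints

section PrimePower

variable {Γ : Type*} [Group Γ]

theorem closure_pow_notMem_normal (M : Subgroup Γ) [hM : M.Normal] (r : ℕ) :
    (Subgroup.closure {x : Γ | x ^ r ∉ M}).Normal := by
  refine ⟨fun x hx g => ?_⟩
  induction hx using Subgroup.closure_induction with
  | mem x hx =>
    refine Subgroup.subset_closure fun h => hx ?_
    rw [conj_pow] at h
    have := hM.conj_mem _ h g⁻¹
    simpa [mul_assoc] using this
  | one => simp
  | mul x y _ _ hx hy =>
    rw [← conj_mul]; exact Subgroup.mul_mem _ hx hy
  | inv x _ hx =>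
    rw [← conj_inv]; exact Subgroup.inv_mem _ hx

variable [Finite Γ]

theorem commute_of_cent_eq_top {M : Subgroup Γ} {c : ℕ} (hc : ∀ g ∉ M, Nat.card (cent g) = c)
    {z : Γ} (hz : z ∉ M) (hz' : cent z = ⊤) (x y : Γ) : Commute x y := by
  have h : ∀ g ∉ M, cent g = ⊤ := fun g hg => by
    refine Subgroup.eq_top_of_card_eq _ ?_
    rw [hc g hg, ← hc z hz, hz', Subgroup.card_top]
  have hcz : ∀ g : Γ, Commute g z := fun g => mem_cent.1 (hz' ▸ Subgroup.mem_top g)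
  have key : ∀ g : Γ, cent g = ⊤ := by
    intro g
    by_cases hg : g ∈ M
    · have h1 : g * z ∉ M := fun h1 => hz ((Subgroup.mul_mem_cancel_left M hg).1 h1)
      have h2 := h _ h1
      rw [eq_top_iff]
      intro x _
      have h3 : Commute x (g * z) := mem_cent.1 (h2 ▸ Subgroup.mem_top x)
      have h4 := h3.mul_right (hcz x).inv_right
      rw [mul_inv_cancel_right] at h4
      exact mem_cent.2 h4
    · exact h g hg
  exact mem_cent.1 (key y ▸ Subgroup.mem_top x)

theorem exists_central_of_nontrivial_quotient {r : ℕ} (hr : r.Prime) (hΓ : IsPGroup r Γ)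
    {M : Subgroup Γ} [M.Normal] (hM : M ≠ ⊤) :
    ∃ x ∉ M, x ^ r ∈ M ∧ ∀ g, (g * x)⁻¹ * (x * g) ∈ M := by
  have : Fact r.Prime := ⟨hr⟩
  have hQ : IsPGroup r (Γ ⧸ M) := hΓ.to_quotient M
  have : Nontrivial (Γ ⧸ M) := by
    rw [← not_subsingleton_iff_nontrivial]
    intro h
    exact hM (QuotientGroup.subgroup_eq_top_of_subsingleton M h)
  have hnt := hQ.center_nontrivial
  have hcard : r ∣ Nat.card (Subgroup.center (Γ ⧸ M)) := by
    rcases (hQ.to_subgroup (Subgroup.center (Γ ⧸ M))).card_eq_or_dvd with h | h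
    · exact absurd h (Finite.one_lt_card_iff_nontrivial.2 hnt).ne'
    · exact h
  obtain ⟨⟨z, hz⟩, hzr⟩ := exists_prime_orderOf_dvd_card' r hcard
  have hzr' : orderOf z = r := by rw [← hzr, Subgroup.orderOf_mk]
  obtain ⟨x, rfl⟩ := QuotientGroup.mk_surjective z
  refine ⟨x, fun hx => ?_, ?_, fun g => ?_⟩
  · rw [(QuotientGroup.eq_one_iff x).2 hx, orderOf_one] at hzr'
    exact hr.one_lt.ne hzr'
  · rw [← QuotientGroup.eq_one_iff, QuotientGroup.mk_pow, ← hzr', pow_orderOf_eq_one]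
  · rw [← QuotientGroup.eq]
    exact Subgroup.mem_center_iff.1 hz g

theorem commute_of_isPGroup_of_card_cent {r : ℕ} (hr : r.Prime) (hΓ : IsPGroup r Γ)
    {M : Subgroup Γ} [hMn : M.Normal] {c : ℕ} (hc : ∀ g ∉ M, Nat.card (cent g) = c) {w : Γ}
    (hw : w ^ r ∉ M) (a b : Γ) : Commute a b := by
  by_contra hab
  have : Fact r.Prime := ⟨hr⟩
  have hZ : ∀ z ∉ M, cent z ≠ ⊤ := fun z hz hz' => hab (commute_of_cent_eq_top hc hz hz' a b)
  have hwM : w ∉ M := fun h => hw (M.pow_mem h r)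
  have hMp : IsPGroup r M := hΓ.to_subgroup M
  set L := Subgroup.closure {x : Γ | x ^ r ∉ M} with hL
  have hLn : L.Normal := closure_pow_notMem_normal M r
  have hS : ∀ x, x ^ r ∉ M → x ∈ L := fun x hx => Subgroup.subset_closure hx
  have hMS : ∀ x, x ^ r ∉ M → M ≤ cent x := fun x hx =>
    le_cent_of_pow_notMem hc hr hMp le_rfl (hΓ x) hx
  have hLM : ∀ m ∈ M, L ≤ cent m := fun m hm =>
    (Subgroup.closure_le _).2 fun x hx => mem_cent_comm.1 (hMS x hx hm)
  have hwL := hS w hw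
  have hML : M ≤ L := by
    intro m hm
    have h1 : w * m ∈ L := hS _ (by rwa [mul_pow_mem_iff hm])
    exact (Subgroup.mul_mem_cancel_left L hwL).1 h1
  have hCw : cent w ≤ L := by
    intro d hd
    by_cases h : d ^ r ∈ M
    · have h1 : d * w ∈ L := hS _ (by
        rw [(mem_cent.1 hd).mul_pow]
        exact fun h2 => hw ((Subgroup.mul_mem_cancel_left M h).1 h2))
      exact (Subgroup.mul_mem_cancel_right L hwL).1 h1
    · exact hS d h
  have hMtop : M ≠ ⊤ := fun h => hwM (h ▸ Subgroup.mem_top w)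
  obtain ⟨x, hxM, hxr, hxc⟩ := exists_central_of_nontrivial_quotient hr hΓ hMtop
  have hxL : x ∈ L := by
    have h1 : (x * w) ^ r ∉ M := by
      intro h2
      have h3 : Commute (x : Γ ⧸ M) (w : Γ ⧸ M) := by
        change (x : Γ ⧸ M) * (w : Γ ⧸ M) = (w : Γ ⧸ M) * (x : Γ ⧸ M)
        rw [← QuotientGroup.mk_mul, ← QuotientGroup.mk_mul]
        exact (QuotientGroup.eq.2 (hxc w)).symm
      rw [← QuotientGroup.eq_one_iff, QuotientGroup.mk_pow, QuotientGroup.mk_mul, h3.mul_pow,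
        ← QuotientGroup.mk_pow, ← QuotientGroup.mk_pow, (QuotientGroup.eq_one_iff _).2 hxr,
        one_mul, QuotientGroup.eq_one_iff] at h2
      exact hw h2
    exact (Subgroup.mul_mem_cancel_right L hwL).1 (hS _ h1)
  have hLx : L ≤ cent x := by
    refine (Subgroup.closure_le _).2 fun g hg => ?_
    obtain ⟨u, hu⟩ : ∃ u, u = g⁻¹ * (x * g * x⁻¹) := ⟨_, rfl⟩
    have huM : u ∈ M := by
      have := hMn.conj_mem _ (hxc g) x
      rw [hu]
      convert this using 1
      group
    have hug : Commute u g := mem_cent.1 (hMS g hg huM)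
    have hux : Commute x u := mem_cent.1 (hLM u huM hxL)
    have hconj : x * g * x⁻¹ = g * u := by rw [hu]; group
    have hpow : ∀ k : ℕ, x ^ k * g * (x ^ k)⁻¹ = g * u ^ k := by
      intro k
      induction k with
      | zero => simp
      | succ k ih =>
        have h3 : x ^ (k + 1) * g * (x ^ (k + 1))⁻¹ = x * (x ^ k * g * (x ^ k)⁻¹) * x⁻¹ := by
          rw [pow_succ']; group
        have h4 : x * u ^ k = u ^ k * x := hux.pow_right k
        rw [h3, ih]
        calc x * (g * u ^ k) * x⁻¹ = x * g * x⁻¹ * (x * u ^ k) * x⁻¹ := by group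
          _ = _ := by rw [h4, hconj, pow_succ']; group
    have hur : u ^ r = 1 := by
      have h3 := hpow r
      have h4 : Commute (x ^ r) g := mem_cent.1 (hMS g hg hxr)
      rw [h4.eq, mul_inv_cancel_right] at h3
      exact left_eq_mul.1 h3
    have hxg : x ∈ cent (g ^ r) := by
      have h3 : x * g ^ r * x⁻¹ = g ^ r := by
        rw [← conj_pow, hconj, hug.symm.mul_pow, hur, mul_one]
      exact mem_cent.2 (mul_inv_eq_iff_eq_mul.1 h3)
    rw [cent_pow_eq hc hg] at hxg
    exact mem_cent_comm.1 hxg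
  have hCwx : cent w = cent x := Subgroup.eq_of_le_of_card_ge (hCw.trans hLx)
    (by rw [hc w hwM, hc x hxM])
  have hLw : L = cent w := le_antisymm (hCwx ▸ hLx) hCw
  have hLtop : L ≠ ⊤ := fun h => hZ w hwM (hLw ▸ h)
  have hout : ∀ g ∉ L, g ^ r ∈ M := fun g hg => by
    by_contra h
    exact hg (hS g h)
  obtain ⟨n₂, hn₂L, -, hn₂c⟩ := exists_central_of_nontrivial_quotient hr hΓ hLtop
  by_cases hcase : ∃ n₁, ∀ i, n₁ * n₂ ^ i ∉ L
  · obtain ⟨n₁, hn₁⟩ := hcase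
    set A := (Subgroup.center L).map L.subtype with hA
    have hAn : A.Normal := ConjAct.normal_of_characteristic_of_normal
    have hAL : A ≤ L := by rintro _ ⟨x, -, rfl⟩; exact x.2
    have hAc : ∀ x ∈ A, ∀ y ∈ L, Commute y x := by
      rintro _ ⟨x, hx, rfl⟩ y hy
      exact congrArg Subtype.val (Subgroup.mem_center_iff.1 hx ⟨y, hy⟩)
    have hwA : w ∈ A := by
      refine ⟨⟨w, hwL⟩, Subgroup.mem_center_iff.2 ?_, rfl⟩
      rintro ⟨y, hy⟩
      rw [hLw] at hy
      exact Subtype.ext (mem_cent.1 hy)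
    have hA'n : (A.map (QuotientGroup.mk' M)).Normal :=
      hAn.map _ (QuotientGroup.mk'_surjective M)
    have hout' : ∀ g ∉ L, ((g : Γ) : Γ ⧸ M) ^ r = 1 := fun g hg => by
      rw [← QuotientGroup.mk_pow, QuotientGroup.eq_one_iff]; exact hout g hg
    have houtA : ∀ g ∉ L, ∀ v ∈ A.map (QuotientGroup.mk' M),
        (v * (g : Γ ⧸ M)) ^ r = (g : Γ ⧸ M) ^ r := by
      rintro g hg _ ⟨y, hy, rfl⟩
      have h1 : y * g ∉ L := fun h => hg ((Subgroup.mul_mem_cancel_left L (hAL hy)).1 h)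
      rw [hout' g hg]
      exact hout' _ h1
    have := pow_prime_eq_one_of_norms_trivial (A := A.map (QuotientGroup.mk' M)) ?_ hr
      (n₁ := (n₁ : Γ ⧸ M)) (n₂ := (n₂ : Γ ⧸ M)) ?_ ?_ ?_ (houtA n₂ hn₂L) _ ⟨w, hwA, rfl⟩
    · apply hw
      rw [← QuotientGroup.eq_one_iff]
      exact this
    · rintro _ ⟨y, hy, rfl⟩ _ ⟨z, hz, rfl⟩
      exact (hAc z hz y (hAL hy)).map _
    · rintro _ ⟨y, hy, rfl⟩
      have h1 : Commute ((n₁ * n₂)⁻¹ * (n₂ * n₁)) y := hAc y hy _ (hn₂c n₁)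
      have h2 : n₁ * n₂ * y * (n₁ * n₂)⁻¹ = n₂ * n₁ * y * (n₂ * n₁)⁻¹ := by
        have h3 : n₂ * n₁ = n₁ * n₂ * ((n₁ * n₂)⁻¹ * (n₂ * n₁)) := by group
        obtain ⟨l, hl⟩ : ∃ l, l = (n₁ * n₂)⁻¹ * (n₂ * n₁) := ⟨_, rfl⟩
        rw [← hl] at h1 h3
        have h4 : l * y = y * l := h1
        rw [h3]
        calc _ = n₁ * n₂ * (y * l) * l⁻¹ * (n₁ * n₂)⁻¹ := by group
          _ = _ := by rw [← h4]; group
      exact congrArg (QuotientGroup.mk' M) h2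
    · intro y _
      rw [hout' n₂ hn₂L]
      exact Commute.one_left y
    · exact fun i _ => houtA _ (hn₁ i)
  · push Not at hcase
    have hn₂M : n₂ ∉ M := fun h => hn₂L (hML h)
    have hidx : L.index = r := by
      have h1 : orderOf (n₂ : Γ ⧸ L) = r := by
        refine orderOf_eq_prime ?_ ?_
        · rw [← QuotientGroup.mk_pow, QuotientGroup.eq_one_iff]
          exact hML (hout n₂ hn₂L)
        · rwa [Ne, QuotientGroup.eq_one_iff]
      rw [Subgroup.index_eq_card, ← h1]
      refine (orderOf_eq_card_of_forall_mem_zpowers fun y => ?_).symm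
      obtain ⟨y, rfl⟩ := QuotientGroup.mk_surjective y
      obtain ⟨i, hi⟩ := hcase y
      rw [← QuotientGroup.eq_one_iff, QuotientGroup.mk_mul, QuotientGroup.mk_pow] at hi
      rw [eq_inv_of_mul_eq_one_left hi]
      exact Subgroup.inv_mem _ (Subgroup.pow_mem _ (Subgroup.mem_zpowers _) _)
    have hidx' : (cent n₂).index = r := by
      have h1 := Subgroup.card_mul_index (cent n₂)
      have h2 := Subgroup.card_mul_index L
      rw [hc n₂ hn₂M, ← h2, hLw, hc w hwM, ← hLw, hidx] at h1
      have hpos : 0 < c := by rw [← hc w hwM]; exact Nat.card_pos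
      exact Nat.eq_of_mul_eq_mul_left hpos h1
    have hmin : (cent n₂).index = (Nat.card Γ).minFac := by
      obtain ⟨k, hk⟩ := hΓ.exists_card_eq
      have hk0 : k ≠ 0 := by
        rintro rfl
        have h1 := Subgroup.index_dvd_card L
        rw [hk, pow_zero, hidx] at h1
        exact hr.one_lt.ne' (Nat.dvd_one.1 h1)
      rw [hidx', hk, hr.pow_minFac hk0]
    have hnorm := Subgroup.normal_of_index_eq_minFac_card hmin
    have h1 : w ^ r ∈ cent n₂ := hidx' ▸ Subgroup.pow_index_mem (cent n₂) w
    have h2 : n₂ ∈ cent w := cent_pow_eq hc hw ▸ mem_cent_comm.1 h1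
    exact hn₂L (hLw ▸ h2)

end PrimePower

section PrimePowerQuotient

variable {G : Type*} [Group G] [Finite G]

theorem factorization_eq_of_mul_eq {r n m c : ℕ} (hr : r.Prime) (hm : ¬ r ∣ m)
    (h : m * r ^ n = c) : r ^ n = r ^ c.factorization r := by
  have hm0 : m ≠ 0 := fun h0 => hm (h0 ▸ dvd_zero r)
  rw [← h, Nat.factorization_mul hm0 (pow_ne_zero _ hr.ne_zero)]
  simp [Nat.factorization_eq_zero_of_not_dvd hm, hr.factorization_self]

theorem sylow_sup_eq_top {r : ℕ} (hr : r.Prime) (R : Sylow r G) {Y : Subgroup G} [Y.Normal]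
    (h : IsPGroup r (G ⧸ Y)) : (R : Subgroup G) ⊔ Y = ⊤ := by
  have : Fact r.Prime := ⟨hr⟩
  rw [← Subgroup.index_eq_one]
  obtain ⟨k, hk⟩ := h.exists_card_eq
  have h1 : ((R : Subgroup G) ⊔ Y).index ∣ r ^ k := by
    rw [← hk, ← Subgroup.index_eq_card]
    exact Subgroup.index_dvd_of_le le_sup_right
  obtain ⟨j, -, hj⟩ := (Nat.dvd_prime_pow hr).1 h1
  rcases Nat.eq_zero_or_pos j with h0 | h0
  · rw [hj, h0, pow_zero]
  · exfalso
    refine R.not_dvd_index ((dvd_pow_self r h0.ne').trans ?_)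
    rw [← hj]
    exact Subgroup.index_dvd_of_le le_sup_left

theorem card_map_cent_eq {r : ℕ} (hr : r.Prime) {Y : Subgroup G} [Y.Normal]
    (hYr : ¬ r ∣ Nat.card Y) (hQ : IsPGroup r (G ⧸ Y)) {x : G} (hx : IsPElement r x) :
    Nat.card (cent (x : G ⧸ Y)) = r ^ (Nat.card (cent x)).factorization r := by
  have : Fact r.Prime := ⟨hr⟩
  obtain ⟨R, hxR⟩ := hx.exists_mem_sylow
  have hmap : cent (x : G ⧸ Y) = (cent x).map (QuotientGroup.mk' Y) := by
    refine le_antisymm ?_ ?_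
    · intro δ hδ
      obtain ⟨d, rfl⟩ := QuotientGroup.mk_surjective δ
      have hd : d ∈ (R : Subgroup G) ⊔ Y := sylow_sup_eq_top hr R hQ ▸ Subgroup.mem_top d
      obtain ⟨ρ, hρ, y, hy, rfl⟩ := Subgroup.mem_sup_of_normal_right.1 hd
      have hρ' : ((ρ * y : G) : G ⧸ Y) = ρ := by
        rw [QuotientGroup.mk_mul, (QuotientGroup.eq_one_iff y).2 hy, mul_one]
      rw [hρ'] at hδ ⊢
      refine ⟨ρ, mem_cent.2 ?_, rfl⟩
      have h1 : (ρ * x)⁻¹ * (x * ρ) ∈ Y := QuotientGroup.eq.1 (mem_cent.1 hδ)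
      have h2 : (ρ * x)⁻¹ * (x * ρ) ∈ (R : Subgroup G) :=
        mul_mem (inv_mem (mul_mem hρ hxR)) (mul_mem hxR hρ)
      have h3 := isPElement_of_not_dvd_eq_one hr hYr h1 (IsPElement.of_mem R.isPGroup' h2)
      exact inv_mul_eq_one.1 h3
    · rintro _ ⟨g, hg, rfl⟩
      exact mem_cent.2 ((mem_cent.1 hg).map (QuotientGroup.mk' Y))
  have hcard : Nat.card ((cent x).map (QuotientGroup.mk' Y)) = Y.relIndex (cent x) := by
    rw [← Subgroup.relIndex_ker, QuotientGroup.ker_mk']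
  obtain ⟨n, hn⟩ := (hQ.to_subgroup (cent (x : G ⧸ Y))).exists_card_eq
  have hmul := Subgroup.card_mul_index (Y.subgroupOf (cent x))
  rw [hn]
  refine factorization_eq_of_mul_eq hr (m := Nat.card (Y.subgroupOf (cent x))) ?_ ?_
  · intro hd
    apply hYr
    refine hd.trans ?_
    rw [← Subgroup.inf_subgroupOf_right, Nat.card_congr (Subgroup.subgroupOfEquivOfLe
      (inf_le_right : Y ⊓ cent x ≤ cent x)).toEquiv]
    exact Subgroup.card_dvd_of_le inf_le_left
  · rw [← hn, hmap, hcard]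
    exact hmul

theorem isCyclic_quotient_of_pow_notMem {N : Subgroup G} [hNn : N.Normal] {c : ℕ}
    (hN : HasPrimeSplittings N) (hc : ∀ g ∉ N, Nat.card (cent g) = c)
    (hpair : ∀ q r : ℕ, q.Prime → r.Prime → q ≠ r → ∀ u v : G, IsPElement q u → IsPElement r v →
      u ∉ N → v ∉ N → ¬ Commute u v)
    {r : ℕ} (hr : r.Prime) {w : G} (hw : IsPElement r w) (hwr : w ^ r ∉ N) (hwtop : cent w ≠ ⊤) :
    IsCyclic (G ⧸ N) ∧ (Nat.card (G ⧸ N)).Coprime (cent w).index := by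
  have : Fact r.Prime := ⟨hr⟩
  obtain ⟨K, Y, hKY⟩ := hN r hr
  have hKn := hKY.normal_left
  have hYn := hKY.normal_right
  have hwN : w ∉ N := fun h => hwr (N.pow_mem h r)
  have hKw : K ≤ cent w := le_cent_of_pow_notMem hc hr hKY.isPGroup hKY.left_le hw hwr
  have hq : ∀ q : ℕ, q.Prime → q ≠ r → ∀ u : G, IsPElement q u → u ∈ N := by
    intro q hq hqr u hu
    by_contra huN
    obtain ⟨v, hv1, hv2, hv3⟩ := exists_isPElement_mem_cent hc hr hKY hwN hw hKw huN
    exact hpair q r hq hr hqr u v hu hv2 huN hv3 (mem_cent.1 hv1).symm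
  have hr' : ∀ u : G, (orderOf u).Coprime r → u ∈ N := by
    intro u hu
    by_contra huN
    obtain ⟨q, j, hq1, hj1, hj2⟩ := exists_isPElement_pow_notMem huN
    refine hj2 (hq q hq1 ?_ _ hj1)
    rintro rfl
    apply hj2
    rw [hj1.eq_one_of_coprime (Nat.Coprime.coprime_dvd_left (orderOf_pow_dvd j) hu)]
    exact N.one_mem
  have hYmem : ∀ u : G, (orderOf u).Coprime r → u ∈ Y := fun u hu => hKY.mem_right hr (hr' u hu) hu
  obtain ⟨b, b', hb⟩ := exists_primePart_exponents G hr
  have hmk : ∀ g : G, (g : G ⧸ Y) = ((g ^ b : G) : G ⧸ Y) := by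
    intro g
    conv_lhs => rw [← (hb g).1]
    rw [QuotientGroup.mk_mul, (QuotientGroup.eq_one_iff (g ^ b')).2 (hYmem _ (hb g).2.2.1), mul_one]
  have hΓ : IsPGroup r (G ⧸ Y) := by
    intro γ
    obtain ⟨g, rfl⟩ := QuotientGroup.mk_surjective γ
    rw [hmk g]
    exact (hb g).2.1.map (QuotientGroup.mk' Y)
  set M := N.map (QuotientGroup.mk' Y) with hM
  have hMn : M.Normal := hNn.map _ (QuotientGroup.mk'_surjective Y)
  have hMmem : ∀ g : G, (g : G ⧸ Y) ∈ M ↔ g ∈ N := by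
    intro g
    have h1 : M.comap (QuotientGroup.mk' Y) = N := by
      rw [hM, Subgroup.comap_map_eq, QuotientGroup.ker_mk', sup_eq_left]
      exact hKY.right_le
    conv_rhs => rw [← h1]
    exact Iff.rfl
  have hcΓ : ∀ γ ∉ M, Nat.card (cent γ) = r ^ c.factorization r := by
    intro γ hγ
    obtain ⟨g, rfl⟩ := QuotientGroup.mk_surjective γ
    rw [hmk g] at hγ ⊢
    rw [hMmem] at hγ
    rw [card_map_cent_eq hr hKY.not_dvd hΓ (hb g).2.1, hc _ hγ]
  have hcomm : ∀ α β : G ⧸ Y, Commute α β :=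
    commute_of_isPGroup_of_card_cent hr hΓ hcΓ (w := (w : G ⧸ Y)) (by
      rw [← QuotientGroup.mk_pow, hMmem]; exact hwr)
  have hcommY : ∀ g h : G, (g * h)⁻¹ * (h * g) ∈ Y := fun g h =>
    QuotientGroup.eq.1 (hcomm g h)
  obtain ⟨R, hwR⟩ := hw.exists_mem_sylow
  have hRY := sylow_sup_eq_top hr R hΓ
  have hRcomm : ∀ g ∈ R, ∀ h ∈ R, Commute g h := by
    intro g hg h hh
    have h2 : (g * h)⁻¹ * (h * g) ∈ (R : Subgroup G) :=
      mul_mem (inv_mem (mul_mem hg hh)) (mul_mem hh hg)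
    have h3 := isPElement_of_not_dvd_eq_one hr hKY.not_dvd (hcommY g h)
      (IsPElement.of_mem R.isPGroup' h2)
    exact inv_mul_eq_one.1 h3
  have hRw : (R : Subgroup G) ≤ cent w := fun g hg => mem_cent.2 (hRcomm g hg w hwR)
  have hGNp : IsPGroup r (G ⧸ N) := by
    intro γ
    obtain ⟨g, rfl⟩ := QuotientGroup.mk_surjective γ
    have : (g : G ⧸ N) = ((g ^ b : G) : G ⧸ N) := by
      conv_lhs => rw [← (hb g).1]
      rw [QuotientGroup.mk_mul, (QuotientGroup.eq_one_iff (g ^ b')).2 (hr' _ (hb g).2.2.1), mul_one]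
    rw [this]
    exact (hb g).2.1.map (QuotientGroup.mk' N)
  refine ⟨?_, ?_⟩
  swap
  · obtain ⟨n, hn⟩ := hGNp.exists_card_eq
    rw [hn]
    refine Nat.Coprime.pow_left n (hr.coprime_iff_not_dvd.2 fun hd => ?_)
    exact R.not_dvd_index (hd.trans (Subgroup.index_dvd_of_le hRw))
  by_contra hcyc
  have hGNcomm : ∀ α β : G ⧸ N, Commute α β := by
    intro α β
    obtain ⟨g, rfl⟩ := QuotientGroup.mk_surjective α
    obtain ⟨h, rfl⟩ := QuotientGroup.mk_surjective β
    exact QuotientGroup.eq.2 (hKY.right_le (hcommY g h))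
  obtain ⟨t, ht, x', y', hx', hy', hy1, hxy⟩ := exists_prime_noncyclic_pair hGNcomm hcyc
  have htr : t = r := by
    by_contra hne
    exact hy1 (IsPElement.eq_one_of_isPElement ht hr hne (isPElement_of_pow_prime_eq_one hy')
      (hGNp y'))
  subst htr
  have hlift : ∀ γ : G ⧸ N, ∃ g ∈ R, (g : G ⧸ N) = γ := by
    intro γ
    obtain ⟨d, rfl⟩ := QuotientGroup.mk_surjective γ
    have hd : d ∈ (R : Subgroup G) ⊔ Y := hRY ▸ Subgroup.mem_top d
    obtain ⟨ρ, hρ, y, hy, rfl⟩ := Subgroup.mem_sup_of_normal_right.1 hd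
    refine ⟨ρ, hρ, ?_⟩
    rw [QuotientGroup.mk_mul, (QuotientGroup.eq_one_iff y).2 (hKY.right_le hy), mul_one]
  obtain ⟨x, hxR, rfl⟩ := hlift x'
  obtain ⟨y, hyR, rfl⟩ := hlift y'
  rw [← QuotientGroup.mk_pow, QuotientGroup.eq_one_iff] at hx' hy'
  rw [Ne, QuotientGroup.eq_one_iff] at hy1
  have hxy' : ∀ i : ℕ, x * y ^ i ∉ N := fun i hi => hxy i (by
    rw [← QuotientGroup.mk_pow, ← QuotientGroup.mk_mul, QuotientGroup.eq_one_iff]; exact hi)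
  have hRK : ∀ g ∈ R, g ∈ N → g ∈ K := fun g hg hgN =>
    hKY.mem_left hr hgN (IsPElement.of_mem R.isPGroup' hg)
  have hcent : ∀ g ∈ R, g ∉ N → g ^ t ∈ N → cent g = cent w := by
    intro g hgR hgN hgt
    refine (Subgroup.eq_of_le_of_card_ge ?_ (by rw [hc g hgN, hc w hwN])).symm
    intro h hh
    have hd : h ∈ (R : Subgroup G) ⊔ Y := hRY ▸ Subgroup.mem_top h
    obtain ⟨ρ, hρ, z, hz, rfl⟩ := Subgroup.mem_sup_of_normal_right.1 hd
    have hzw : z ∈ cent w := (Subgroup.mul_mem_cancel_left _ (hRw hρ)).1 hh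
    have hwg := hRcomm w hwR g hgR
    have h1 : (w * g) ^ t ∉ N := by
      rw [hwg.mul_pow]
      exact fun h1 => hwr ((Subgroup.mul_mem_cancel_right N hgt).1 h1)
    have h2 : z ∈ cent ((w * g) ^ t) := by
      rw [hwg.mul_pow]
      exact mem_cent.2 (((mem_cent.1 hzw).pow_right t).mul_right
        (hKY.commute hr (hRK _ (pow_mem hgR t) hgt) hz).symm)
    rw [cent_pow_eq hc h1] at h2
    have h3 := (mem_cent.1 hzw).inv_right.mul_right (mem_cent.1 h2)
    rw [inv_mul_cancel_left] at h3
    exact (cent g).mul_mem (mem_cent.2 (hRcomm ρ hρ g hgR)) (mem_cent.2 h3)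
  have hcy := hcent y hyR hy1 hy'
  have hcxy : ∀ i : ℕ, cent (x * y ^ i) = cent y := by
    intro i
    rw [hcy]
    refine hcent _ (mul_mem hxR (pow_mem hyR i)) (hxy' i) ?_
    rw [((hRcomm x hxR y hyR).pow_right i).mul_pow, ← pow_mul, mul_comm i, pow_mul]
    exact N.mul_mem hx' (N.pow_mem hy' i)
  have hYnil := isNilpotent_of_le hN.isNilpotent hKY.right_le
  have hYy := right_le_cent_of_cent_mul_pow_eq hr hKY hYnil (hRcomm x hxR y hyR)
    (hRK _ (pow_mem hxR t) hx') (hRK _ (pow_mem hyR t) hy') hcxy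
  apply hwtop
  rw [eq_top_iff, ← hRY]
  exact sup_le hRw (hcy ▸ hYy)

end PrimePowerQuotient

section AbelianPartition

theorem eq_one_of_sub_one_dvd_of_prime_parts_lt {k e : ℕ} (hk : k ≠ 0) (he : e ≠ 0)
    (hdvd : k - 1 ∣ k * e - 1) {p q : ℕ} (hp : p ∈ k.primeFactors) (hq : q ∈ k.primeFactors)
    (hpq : p ≠ q) (hprime : e.primeFactors ⊆ k.primeFactors)
    (hlt : ∀ t ∈ k.primeFactors, ∀ r ∈ k.primeFactors, t ≠ r →
      t ^ e.factorization t < r ^ k.factorization r) : e = 1 := by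
  obtain ⟨m, hm, hmin⟩ := Finset.exists_min_image k.primeFactors
    (fun r => r ^ k.factorization r) ⟨p, hp⟩
  obtain ⟨r, hr, hrm⟩ : ∃ r ∈ k.primeFactors, r ≠ m := by
    by_cases h : p = m
    · exact ⟨q, hq, fun h' => hpq (h.trans h'.symm)⟩
    · exact ⟨p, hp, h⟩
  have hek : e < k := by
    rw [← Nat.prod_factorization_pow_eq_self he, ← Nat.prod_factorization_pow_eq_self hk]
    rw [Finsupp.prod_of_support_subset (s := k.primeFactors) _ hprime _ (by simp)]
    rw [Finsupp.prod, Nat.support_factorization]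
    rw [← Equiv.Perm.prod_comp (Equiv.swap m r) k.primeFactors
      (fun t => t ^ k.factorization t) (by
        intro a ha
        by_contra h
        exact ha (Equiv.swap_apply_of_ne_of_ne (fun h' => h (h' ▸ hm)) (fun h' => h (h' ▸ hr))))]
    refine Finset.prod_lt_prod_of_nonempty
      (fun t ht => pow_pos (Nat.prime_of_mem_primeFactors ht).pos _) (fun t ht => ?_) ⟨p, hp⟩
    rcases eq_or_ne t m with rfl | htm
    · rw [Equiv.swap_apply_left]
      exact hlt _ hm _ hr hrm.symm
    rcases eq_or_ne t r with rfl | htr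
    · rw [Equiv.swap_apply_right]
      exact hlt _ hr _ hm hrm
    · rw [Equiv.swap_apply_of_ne_of_ne htm htr]
      exact (hlt _ ht _ hm htm).trans_le (hmin t ht)
  have h1 : k * e - 1 = (k - 1) * e + (e - 1) := by
    obtain ⟨j, rfl⟩ := Nat.exists_eq_succ_of_ne_zero hk
    obtain ⟨i, rfl⟩ := Nat.exists_eq_succ_of_ne_zero he
    simp only [Nat.succ_eq_add_one, Nat.add_sub_cancel]
    rw [Nat.sub_eq_iff_eq_add (by nlinarith)]
    ring
  have h2 : k - 1 ∣ e - 1 := (Nat.dvd_add_right (Dvd.intro _ rfl)).1 (h1 ▸ hdvd)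
  by_contra h3
  have := Nat.le_of_dvd (by omega) h2
  omega

variable {H : Type*} [Group H] [Finite H]

theorem card_le_pow_factorization {t : ℕ} (ht : t.Prime) {A B : Subgroup H} (hBA : B ≤ A)
    (hB : IsPGroup t B) : Nat.card B ≤ t ^ (Nat.card A).factorization t := by
  have : Fact t.Prime := ⟨ht⟩
  obtain ⟨n, hn⟩ := hB.exists_card_eq
  have h1 := Subgroup.card_dvd_of_le hBA
  rw [hn] at h1 ⊢
  exact Nat.pow_le_pow_right ht.pos ((ht.pow_dvd_iff_le_factorization Nat.card_pos.ne').1 h1)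

theorem ncard_isPElement_ne_one_lt {r : ℕ} (hr : r.Prime) {A : Subgroup H}
    (hA : ∀ a ∈ A, ∀ b ∈ A, Commute a b) :
    {y | y ∈ A ∧ IsPElement r y ∧ y ≠ 1}.ncard < r ^ (Nat.card A).factorization r := by
  let R : Subgroup H :=
    { carrier := {y | y ∈ A ∧ IsPElement r y}
      mul_mem' := fun ha hb => ⟨mul_mem ha.1 hb.1, ha.2.mul_of_commute hb.2 (hA _ ha.1 _ hb.1)⟩
      one_mem' := ⟨A.one_mem, .one r⟩
      inv_mem' := fun ha => ⟨inv_mem ha.1, ha.2.inv⟩ }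
  have hRA : R ≤ A := fun y hy => hy.1
  refine lt_of_lt_of_le ?_ (card_le_pow_factorization hr hRA
    (isPGroup_of_forall_isPElement fun g hg => hg.2))
  rw [← SetLike.coe_sort_coe, Nat.card_coe_set_eq]
  refine Set.ncard_lt_ncard ⟨fun y hy => ⟨hy.1, hy.2.1⟩, fun h => ?_⟩
  exact (h R.one_mem).2.2 rfl

/-- A partition of a finite group into abelian subgroups of equal order, permuted by
conjugation. -/
structure IsAbelianPartition (𝒜 : Set (Subgroup H)) (k : ℕ) : Prop where
  commute : ∀ A ∈ 𝒜, ∀ a ∈ A, ∀ b ∈ A, Commute a b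
  exists_mem : ∀ x : H, ∃ A ∈ 𝒜, x ∈ A
  eq_of_mem : ∀ A ∈ 𝒜, ∀ B ∈ 𝒜, ∀ x ∈ A, x ∈ B → x ≠ 1 → A = B
  conj : ∀ A ∈ 𝒜, ∀ n : H, ∃ B ∈ 𝒜, ∀ x ∈ A, n * x * n⁻¹ ∈ B
  card_eq : ∀ A ∈ 𝒜, Nat.card A = k

namespace IsAbelianPartition

variable {𝒜 : Set (Subgroup H)} {k : ℕ}

theorem sub_one_dvd (h : IsAbelianPartition 𝒜 k) : k - 1 ∣ Nat.card H - 1 := by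
  have := Fintype.ofFinite H
  choose f hf hxf using h.exists_mem
  have h1 := Finset.card_eq_sum_card_fiberwise (f := f) (s := Finset.univ.erase (1 : H))
    (t := Finset.univ.image f) (by intro x _; simp)
  rw [Finset.card_erase_of_mem (Finset.mem_univ _), Finset.card_univ,
    ← Nat.card_eq_fintype_card] at h1
  rw [h1]
  refine Finset.dvd_sum fun A hA => ?_
  obtain ⟨x, -, rfl⟩ := Finset.mem_image.1 hA
  rw [← h.card_eq _ (hf x)]
  have h2 : ({y ∈ Finset.univ.erase (1 : H) | f y = f x}) =
      (Finset.univ.filter (· ∈ f x)).erase 1 := by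
    ext y
    simp only [Finset.mem_filter, Finset.mem_erase, Finset.mem_univ, and_true, true_and]
    refine and_congr_right fun hy => ⟨fun hxy => hxy ▸ hxf y, fun hyx => ?_⟩
    exact h.eq_of_mem _ (hf y) _ (hf x) y (hxf y) hyx hy
  rw [h2, Finset.card_erase_of_mem (by simp [one_mem]), ← Fintype.card_subtype,
    ← Nat.card_eq_fintype_card]

theorem mem_of_commute (h : IsAbelianPartition 𝒜 k) {q r : ℕ} (hq : q.Prime) (hr : r.Prime)
    (hqr : q ≠ r) {A : Subgroup H} (hA : A ∈ 𝒜) {x n : H} (hx : x ∈ A) (hx1 : x ≠ 1)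
    (hxr : IsPElement r x) (hn : IsPElement q n) (hc : Commute x n) : n ∈ A := by
  obtain ⟨b, b', hb⟩ := exists_primePart_exponents H hr
  obtain ⟨B, hB, hxn⟩ := h.exists_mem (x * n)
  have h1 : (x * n) ^ b = x := by
    rw [hc.mul_pow, (hb x).2.2.2.1 hxr, (hb n).2.2.2.2, mul_one]
    obtain ⟨j, hj⟩ := hn
    exact Nat.Coprime.coprime_dvd_left (orderOf_dvd_of_pow_eq_one hj)
      (Nat.Coprime.pow_left _ ((Nat.coprime_primes hq hr).2 hqr))
  have hxB : x ∈ B := h1 ▸ pow_mem hxn b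
  have hAB := h.eq_of_mem A hA B hB x hx hxB hx1
  subst hAB
  exact (Subgroup.mul_mem_cancel_left A hx).1 hxn

theorem exists_sylow_normalizing (h : IsAbelianPartition 𝒜 k) {q : ℕ} (hq : q.Prime)
    (hqH : q ∣ Nat.card H) (Q : Sylow q H) :
    q ∣ k ∧ ∃ A ∈ 𝒜, ∀ n ∈ Q, ∀ x ∈ A, n * x * n⁻¹ ∈ A := by
  have : Fact q.Prime := ⟨hq⟩
  have hQ1 : Nontrivial Q := by
    rw [← Finite.one_lt_card_iff_nontrivial]
    exact (Nat.le_of_dvd Nat.card_pos (Q.dvd_card_of_dvd_card hqH)).trans_lt' hq.one_lt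
  have := Q.isPGroup'.center_nontrivial
  obtain ⟨z, hz⟩ := exists_ne (1 : Subgroup.center Q)
  have hz1 : ((z : Q) : H) ≠ 1 := fun h1 => hz (Subtype.ext (Subtype.ext h1))
  obtain ⟨A, hA, hzA⟩ := h.exists_mem ((z : Q) : H)
  refine ⟨?_, A, hA, fun n hn x hx => ?_⟩
  · rw [← h.card_eq A hA]
    by_contra hd
    exact hz1 (isPElement_of_not_dvd_eq_one hq hd hzA (IsPElement.of_mem Q.isPGroup' (z : Q).2))
  · obtain ⟨B, hB, hAB⟩ := h.conj A hA n
    have h1 : n * ((z : Q) : H) * n⁻¹ = (z : Q) := by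
      have h2 := congrArg Subtype.val (Subgroup.mem_center_iff.1 z.2 ⟨n, hn⟩)
      rw [mul_inv_eq_iff_eq_mul]
      exact h2
    have h3 := h.eq_of_mem A hA B hB _ hzA (h1 ▸ hAB _ hzA) hz1
    exact h3 ▸ hAB x hx

theorem card_sylow_lt (h : IsAbelianPartition 𝒜 k) {q r : ℕ} (hq : q.Prime)
    (hqH : q ∣ Nat.card H) (hr : r.Prime) (hrk : r ∣ k) (hqr : q ≠ r) (Q : Sylow q H) :
    Nat.card Q < q ^ k.factorization q * r ^ k.factorization r := by
  have := Fintype.ofFinite H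
  have : Fact r.Prime := ⟨hr⟩
  obtain ⟨-, A, hA, hQA⟩ := h.exists_sylow_normalizing hq hqH Q
  have hAk := h.card_eq A hA
  obtain ⟨x, hx⟩ := exists_prime_orderOf_dvd_card' (G := A) r (hAk ▸ hrk)
  have hx1 : (x : H) ≠ 1 := fun h1 => hr.one_lt.ne' (by
    rw [← hx, show x = 1 from Subtype.ext h1, orderOf_one])
  have hxr : IsPElement r (x : H) := isPElement_of_pow_prime_eq_one (by
    rw [← hx, ← Subgroup.orderOf_coe, pow_orderOf_eq_one])
  have h1 := Finset.card_le_mul_card_image (f := fun n : H => n * x * n⁻¹)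
    (Finset.univ.filter (· ∈ Q)) (Nat.card ↥((Q : Subgroup H) ⊓ A)) (by
      intro a ha
      obtain ⟨n, hn, rfl⟩ := Finset.mem_image.1 ha
      rw [Finset.mem_filter] at hn
      rw [Nat.card_eq_fintype_card, Fintype.card_subtype]
      refine Finset.card_le_card_of_injOn (fun m => n⁻¹ * m) ?_
        (fun _ _ _ _ h2 => mul_left_cancel h2)
      intro m hm
      simp only [Finset.coe_filter, Finset.mem_filter, Finset.mem_univ, true_and,
        Set.mem_ofPred_eq] at hm ⊢
      have hmQ : n⁻¹ * m ∈ Q := mul_mem (inv_mem hn.2) hm.1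
      refine ⟨hmQ, h.mem_of_commute hq hr hqr hA x.2 hx1 hxr
        (IsPElement.of_mem Q.isPGroup' hmQ) ?_⟩
      have h3 : m * x = n * x * n⁻¹ * m := by rw [← hm.2]; group
      show (x : H) * (n⁻¹ * m) = n⁻¹ * m * x
      rw [mul_assoc n⁻¹, h3]
      group)
  have h2 : (Finset.univ.filter (· ∈ Q)).card = Nat.card Q := by
    rw [Nat.card_eq_fintype_card, ← Fintype.card_subtype]
    rfl
  have h3 : ((Finset.univ.filter (· ∈ Q)).image fun n : H => n * x * n⁻¹).card <
      r ^ k.factorization r := by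
    refine lt_of_le_of_lt ?_ (hAk ▸ ncard_isPElement_ne_one_lt hr (h.commute A hA))
    rw [← Set.ncard_coe_finset]
    refine Set.ncard_le_ncard ?_
    intro y hy
    obtain ⟨n, hn, rfl⟩ := Finset.mem_image.1 hy
    refine ⟨hQA n (Finset.mem_filter.1 hn).2 x x.2, hxr.conj n, fun h4 => hx1 ?_⟩
    exact conj_eq_one_iff.1 h4
  rw [h2] at h1
  refine h1.trans_lt (lt_of_le_of_lt (Nat.mul_le_mul_right _ (card_le_pow_factorization hq
    (inf_le_right) (Q.isPGroup'.to_le inf_le_left))) ?_)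
  rw [hAk]
  exact Nat.mul_lt_mul_of_pos_left h3 (pow_pos hq.pos _)

theorem eq_top (h : IsAbelianPartition 𝒜 k) {p q : ℕ} (hp : p.Prime) (hq : q.Prime) (hpq : p ≠ q)
    (hpk : p ∣ k) (hqk : q ∣ k) {A : Subgroup H} (hA : A ∈ 𝒜) : A = ⊤ := by
  have hk : k ≠ 0 := h.card_eq A hA ▸ Nat.card_pos.ne'
  have hAi : k * A.index = Nat.card H := h.card_eq A hA ▸ A.card_mul_index
  have hi : A.index ≠ 0 := Subgroup.index_ne_zero_of_finite
  have hprime : ∀ t : ℕ, t.Prime → t ∣ Nat.card H → t ∣ k := fun t ht htH => by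
    have : Fact t.Prime := ⟨ht⟩
    exact (h.exists_sylow_normalizing ht htH default).1
  rw [← Subgroup.index_eq_one]
  refine eq_one_of_sub_one_dvd_of_prime_parts_lt hk hi (hAi ▸ h.sub_one_dvd)
    (Nat.mem_primeFactors.2 ⟨hp, hpk, hk⟩) (Nat.mem_primeFactors.2 ⟨hq, hqk, hk⟩) hpq ?_ ?_
  · intro t ht
    rw [Nat.mem_primeFactors] at ht ⊢
    exact ⟨ht.1, hprime t ht.1 (hAi ▸ ht.2.1.mul_left k), hk⟩
  · intro t ht r hr htr
    rw [Nat.mem_primeFactors] at ht hr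
    have : Fact t.Prime := ⟨ht.1⟩
    have h1 := h.card_sylow_lt ht.1 (hAi ▸ ht.2.1.mul_right _) hr.1 hr.2.1 htr default
    rw [Sylow.card_eq_multiplicity, ← hAi, Nat.factorization_mul hk hi, Finsupp.add_apply,
      pow_add] at h1
    exact Nat.lt_of_mul_lt_mul_left h1

end IsAbelianPartition

end AbelianPartition

section CommutingPair

variable {G : Type*} [Group G] [Finite G]

theorem not_dvd_index_of_sup_eq_top {t : ℕ} {S Y : Subgroup G} [Y.Normal]
    (hY : ¬ t ∣ Nat.card Y) (h : S ⊔ Y = ⊤) : ¬ t ∣ S.index := by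
  have h1 := card_sup_mul_card_inf S Y
  rw [h, Subgroup.card_top, ← S.card_mul_index, mul_assoc] at h1
  have h2 := Nat.eq_of_mul_eq_mul_left Nat.card_pos h1
  exact fun hd => hY (h2 ▸ hd.mul_right _)

theorem exists_conj_mem {t : ℕ} (ht : t.Prime) {S Y : Subgroup G} [hYn : Y.Normal]
    (hS : IsPGroup t S) (hY : ¬ t ∣ Nat.card Y) {a : G} (ha : a ∈ S ⊔ Y) (hat : IsPElement t a) :
    ∃ g ∈ S ⊔ Y, g * a * g⁻¹ ∈ S := by
  have : Fact t.Prime := ⟨ht⟩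
  set L := S ⊔ Y with hL
  have hYL : ¬ t ∣ Nat.card (Y.subgroupOf L) := by
    rwa [Nat.card_congr (Subgroup.subgroupOfEquivOfLe (le_sup_right : Y ≤ L)).toEquiv]
  have hSL : S.subgroupOf L ⊔ Y.subgroupOf L = ⊤ := by
    rw [← Subgroup.subgroupOf_sup le_sup_left le_sup_right]
    exact Subgroup.subgroupOf_self L
  have hSp : IsPGroup t (S.subgroupOf L) := hS.comap_subtype
  have hSi := not_dvd_index_of_sup_eq_top hYL hSL
  obtain ⟨k, hk⟩ := hat
  obtain ⟨P, hP⟩ := IsPElement.exists_mem_sylow (g := (⟨a, ha⟩ : L)) ⟨k, Subtype.ext hk⟩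
  obtain ⟨g, hg⟩ := MulAction.exists_smul_eq L P (hSp.toSylow hSi)
  refine ⟨g, g.2, ?_⟩
  have h1 : g * ⟨a, ha⟩ * g⁻¹ ∈ g • P := by
    rw [← SetLike.mem_coe, Sylow.coe_smul]
    exact ⟨⟨a, ha⟩, hP, rfl⟩
  rw [hg] at h1
  exact h1

theorem exists_isPElement_mk_eq {t : ℕ} (ht : t.Prime) {N : Subgroup G} [N.Normal] {C : Subgroup G}
    {γ : G ⧸ N} (hγ : IsPElement t γ) (h : γ ∈ C.map (QuotientGroup.mk' N)) :
    ∃ x ∈ C, IsPElement t x ∧ (x : G ⧸ N) = γ := by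
  obtain ⟨x, hx, rfl⟩ := h
  obtain ⟨b, b', hb⟩ := exists_primePart_exponents G ht
  refine ⟨x ^ b, pow_mem hx b, (hb x).2.1, ?_⟩
  have h1 : ((x ^ b' : G) : G ⧸ N) = 1 := by
    refine IsPElement.eq_one_of_coprime (p := t) ?_ ?_
    · rw [QuotientGroup.mk_pow]
      exact hγ.pow b'
    · exact Nat.Coprime.coprime_dvd_left (orderOf_map_dvd (QuotientGroup.mk' N) _) (hb x).2.2.1
  conv_rhs => rw [← (hb x).1]
  rw [QuotientGroup.mk'_apply, QuotientGroup.mk_mul, h1, mul_one]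

variable {N : Subgroup G} {c : ℕ}

theorem commute_of_mem_cent_of_isPElement (hc : ∀ g ∉ N, Nat.card (cent g) = c) {q r : ℕ}
    (hq : q.Prime) (hr : r.Prime) (hqr : q ≠ r) {u v : G} (hu : IsPElement q u)
    (hv : IsPElement r v) (huN : u ∉ N) (hvN : v ∉ N) (huv : Commute u v) {x y : G}
    (hx : x ∈ cent u) (hy : y ∈ cent u) : Commute x y := by
  have hcv := cent_eq_cent_of_coprime hc huN hvN huv (IsPElement.coprime hq hr hqr hu hv)
  obtain ⟨b, b', hb⟩ := exists_primePart_exponents G hq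
  rw [← (hb y).1]
  have hyu := mem_cent.1 hy
  have hyv := mem_cent.1 (hcv ▸ hy)
  refine Commute.mul_right ?_ ?_
  · exact mem_cent.1 (cent_le_cent_of_coprime hc hvN (hyv.symm.pow_right b)
      (IsPElement.coprime hr hq hqr.symm hv (hb y).2.1) (hcv ▸ hx))
  · exact mem_cent.1 (cent_le_cent_of_coprime hc huN (hyu.symm.pow_right b')
      (hu.coprime_right (hb y).2.2.1).symm hx)

/-- Centralizers outside `N` all have the same order, are abelian, and each contains elements
outside `N` of prime power order for every prime in a set of at least two primes. -/
structure IsCentralizerFamily (N : Subgroup G) (c q r : ℕ) : Prop where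
  card_cent : ∀ g ∉ N, Nat.card (cent g) = c
  prime_left : q.Prime
  prime_right : r.Prime
  ne : q ≠ r
  commute : ∀ g ∉ N, ∀ x ∈ cent g, ∀ y ∈ cent g, Commute x y
  exists_left : ∀ g ∉ N, ∃ u ∈ cent g, IsPElement q u ∧ u ∉ N
  exists_right : ∀ g ∉ N, ∃ v ∈ cent g, IsPElement r v ∧ v ∉ N

theorem isCentralizerFamily_of_commute (hN : HasPrimeSplittings N)
    (hc : ∀ g ∉ N, Nat.card (cent g) = c) {q r : ℕ} (hq : q.Prime) (hr : r.Prime) (hqr : q ≠ r)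
    {u v : G} (hu : IsPElement q u) (hv : IsPElement r v) (huN : u ∉ N) (hvN : v ∉ N)
    (huv : Commute u v) : IsCentralizerFamily N c q r := by
  have hcop := IsPElement.coprime hq hr hqr hu hv
  have hcv := cent_eq_cent_of_coprime hc huN hvN huv hcop
  have hq' : ∀ g ∉ N, ∃ u ∈ cent g, IsPElement q u ∧ u ∉ N := fun g hg => by
    obtain ⟨K, Y, hKY⟩ := hN q hq
    have := hKY.normal_left
    refine exists_isPElement_mem_cent hc hq hKY huN hu ?_ hg
    rw [hcv]
    exact le_cent_of_cent_eq hq hKY.isPGroup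
      (IsPElement.coprime_right hv ((Nat.coprime_primes hq hr).2 hqr)).symm hu hcv.symm
  have hr' : ∀ g ∉ N, ∃ v ∈ cent g, IsPElement r v ∧ v ∉ N := fun g hg => by
    obtain ⟨K, Y, hKY⟩ := hN r hr
    have := hKY.normal_left
    refine exists_isPElement_mem_cent hc hr hKY hvN hv ?_ hg
    rw [← hcv]
    exact le_cent_of_cent_eq hr hKY.isPGroup
      (IsPElement.coprime_right hu ((Nat.coprime_primes hr hq).2 hqr.symm)).symm hv hcv
  refine ⟨hc, hq, hr, hqr, fun g hg x hx y hy => ?_, hq', hr'⟩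
  obtain ⟨t, j, ht, hgt, hgN⟩ := exists_isPElement_pow_notMem hg
  rw [← cent_pow_eq hc hgN] at hx hy
  by_cases htq : t = q
  · subst htq
    obtain ⟨w, hw, hwr, hwN⟩ := hr' _ hgN
    exact commute_of_mem_cent_of_isPElement hc hq hr hqr hgt hwr hgN hwN (mem_cent.1 hw).symm hx hy
  · obtain ⟨w, hw, hwq, hwN⟩ := hq' _ hgN
    exact commute_of_mem_cent_of_isPElement hc ht hq htq hgt hwq hgN hwN (mem_cent.1 hw).symm hx hy

namespace IsCentralizerFamily

variable {q r : ℕ}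

theorem cent_eq (h : IsCentralizerFamily N c q r) {g x : G} (hg : g ∉ N) (hx : x ∈ cent g)
    (hxN : x ∉ N) : cent x = cent g :=
  (Subgroup.eq_of_le_of_card_ge (fun _ hy => mem_cent.2 (h.commute g hg _ hy x hx))
    (by rw [h.card_cent g hg, h.card_cent x hxN])).symm

theorem le_cent (h : IsCentralizerFamily N c q r) {t : ℕ} (ht : t.Prime) {K : Subgroup G}
    [K.Normal] (hK : IsPGroup t K) {x : G} (hxt : IsPElement t x) (hxN : x ∉ N) : K ≤ cent x := by
  obtain ⟨s, w, hs, hst, hw, hws, hwN⟩ : ∃ s w, s.Prime ∧ s ≠ t ∧ w ∈ cent x ∧ IsPElement s w ∧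
      w ∉ N := by
    by_cases htq : q = t
    · obtain ⟨w, hw⟩ := h.exists_right x hxN
      exact ⟨r, w, h.prime_right, fun hrt => h.ne (htq.trans hrt.symm), hw⟩
    · obtain ⟨w, hw⟩ := h.exists_left x hxN
      exact ⟨q, w, h.prime_left, htq, hw⟩
  have hcw := h.cent_eq hxN hw hwN
  rw [← hcw]
  exact le_cent_of_cent_eq ht hK
    (IsPElement.coprime_right hws ((Nat.coprime_primes ht hs).2 hst.symm)).symm hxt hcw

theorem card_inf_cent_dvd (h : IsCentralizerFamily N c q r) (hN : HasPrimeSplittings N) {g g' : G}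
    (hg : g ∉ N) (hg' : g' ∉ N) : Nat.card ↥(N ⊓ cent g) ∣ Nat.card ↥(N ⊓ cent g') := by
  rw [Nat.dvd_iff_prime_pow_dvd_dvd]
  intro t n ht hd
  have : Fact t.Prime := ⟨ht⟩
  by_cases hx : ∃ x ∈ cent g', IsPElement t x ∧ x ∉ N
  · obtain ⟨x, hx, hxt, hxN⟩ := hx
    obtain ⟨K, Y, hKY⟩ := hN t ht
    have := hKY.normal_left
    have := hKY.normal_right
    have hK : K ≤ cent g' := h.cent_eq hg' hx hxN ▸ h.le_cent ht hKY.isPGroup hxt hxN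
    have h1 := card_sup_mul_card_inf K Y
    rw [hKY.inf_eq_bot ht, Subgroup.card_bot, mul_one, hKY.sup_eq] at h1
    have h2 := hd.trans (Subgroup.card_dvd_of_le inf_le_left)
    rw [h1] at h2
    refine (Nat.Coprime.dvd_of_dvd_mul_right ?_ h2).trans
      (Subgroup.card_dvd_of_le (le_inf hKY.left_le hK))
    exact Nat.Coprime.pow_left n ((ht.coprime_iff_not_dvd).2 hKY.not_dvd)
  · push Not at hx
    have h1 := hd.trans (Subgroup.card_dvd_of_le inf_le_right)
    rw [h.card_cent g hg, ← h.card_cent g' hg'] at h1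
    obtain ⟨T, hT⟩ := Sylow.exists_subgroup_card_pow_prime t h1
    rw [← hT, Nat.card_congr (T.equivMapOfInjective _ (cent g').subtype_injective).toEquiv]
    refine Subgroup.card_dvd_of_le (le_inf ?_ (Subgroup.map_subtype_le T))
    rintro _ ⟨y, hy, rfl⟩
    exact hx y y.2 ((IsPElement.of_mem (IsPGroup.of_card hT) hy).map (cent g').subtype)

variable [hNn : N.Normal]

theorem map_cent_le_of_isPElement (h : IsCentralizerFamily N c q r) (hN : HasPrimeSplittings N)
    {t : ℕ} (ht : t.Prime) {a a' : G} (ha : IsPElement t a) (ha' : IsPElement t a') (haN : a ∉ N)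
    (haN' : a' ∉ N) (haa : (a : G ⧸ N) = a') :
    (cent a).map (QuotientGroup.mk' N) ≤ (cent a').map (QuotientGroup.mk' N) := by
  obtain ⟨K, Y, hKY⟩ := hN t ht
  have := hKY.normal_left
  have := hKY.normal_right
  have hS := isPGroup_sup_zpowers hKY.isPGroup ha'
  set S := K ⊔ Subgroup.zpowers a' with hSdef
  have hSc : S ≤ cent a' := sup_le (h.le_cent ht hKY.isPGroup ha' haN')
    ((Subgroup.zpowers_le).2 (self_mem_cent a'))
  have hNS : N ≤ S ⊔ Y := by
    rw [← hKY.sup_eq]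
    exact sup_le_sup_right le_sup_left Y
  have ha'S : a' ∈ S := (le_sup_right : _ ≤ S) (Subgroup.mem_zpowers a')
  have haS : a ∈ S ⊔ Y := by
    have h1 : a'⁻¹ * a ∈ N := QuotientGroup.eq.1 haa.symm
    have h2 := mul_mem ((le_sup_left : S ≤ S ⊔ Y) ha'S) (hNS h1)
    rwa [mul_inv_cancel_left] at h2
  obtain ⟨g, hg, hgS⟩ := exists_conj_mem ht hS hKY.not_dvd haS ha
  have hgN : g * a * g⁻¹ ∉ N := fun h1 =>
    haN (by simpa [mul_assoc] using hNn.conj_mem' _ h1 g)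
  have hcg := h.cent_eq haN' (hSc hgS) hgN
  have hgc : (g : G ⧸ N) ∈ (cent a').map (QuotientGroup.mk' N) := by
    obtain ⟨s, hs, y, hy, rfl⟩ := Subgroup.mem_sup_of_normal_right.1 hg
    refine ⟨s, hSc hs, ?_⟩
    rw [QuotientGroup.mk_mul, (QuotientGroup.eq_one_iff y).2 (hKY.right_le hy), mul_one]
    rfl
  obtain ⟨d, hd, hdg⟩ := hgc
  have hdg' : (d : G ⧸ N) = g := hdg
  rintro _ ⟨z, hz, rfl⟩
  have h1 : g * z * g⁻¹ ∈ cent a' := hcg ▸ (conj_mem_cent g).2 hz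
  refine ⟨d⁻¹ * (g * z * g⁻¹) * d, mul_mem (mul_mem (inv_mem hd) h1) hd, ?_⟩
  show ((d⁻¹ * (g * z * g⁻¹) * d : G) : G ⧸ N) = z
  simp only [QuotientGroup.mk_mul, QuotientGroup.mk_inv, hdg']
  group

theorem map_cent_eq (h : IsCentralizerFamily N c q r) (hN : HasPrimeSplittings N) {a a' : G}
    (haN : a ∉ N) (haa : (a : G ⧸ N) = a') :
    (cent a).map (QuotientGroup.mk' N) = (cent a').map (QuotientGroup.mk' N) := by
  obtain ⟨t, j, ht, hat, hajN⟩ := exists_isPElement_pow_notMem haN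
  obtain ⟨b, b', hb⟩ := exists_primePart_exponents G ht
  have habN : a ^ b ∉ N := fun h1 => hajN (by
    rw [← (hb _).2.2.2.1 hat, ← pow_mul, mul_comm, pow_mul]
    exact N.pow_mem h1 j)
  have hab : ((a ^ b : G) : G ⧸ N) = (a' ^ b : G) := by
    rw [QuotientGroup.mk_pow, QuotientGroup.mk_pow, haa]
  have habN' : a' ^ b ∉ N := by
    rwa [← QuotientGroup.eq_one_iff, ← hab, QuotientGroup.eq_one_iff]
  rw [← cent_pow_eq h.card_cent habN, ← cent_pow_eq h.card_cent habN']
  exact le_antisymm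
    (h.map_cent_le_of_isPElement hN ht (hb a).2.1 (hb a').2.1 habN habN' hab)
    (h.map_cent_le_of_isPElement hN ht (hb a').2.1 (hb a).2.1 habN' habN hab.symm)

theorem isAbelianPartition (h : IsCentralizerFamily N c q r) (hN : HasPrimeSplittings N) {g : G}
    (hg : g ∉ N) : IsAbelianPartition {A | ∃ x ∉ N, (cent x).map (QuotientGroup.mk' N) = A}
      (Nat.card ((cent g).map (QuotientGroup.mk' N))) where
  commute := by
    rintro _ ⟨x, hx, rfl⟩ _ ⟨a, ha, rfl⟩ _ ⟨b, hb, rfl⟩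
    exact (h.commute x hx a ha b hb).map (QuotientGroup.mk' N)
  exists_mem γ := by
    obtain ⟨x, rfl⟩ := QuotientGroup.mk_surjective γ
    by_cases hx : x ∈ N
    · refine ⟨_, ⟨g, hg, rfl⟩, ?_⟩
      rw [(QuotientGroup.eq_one_iff x).2 hx]
      exact one_mem _
    · exact ⟨_, ⟨x, hx, rfl⟩, x, self_mem_cent x, rfl⟩
  eq_of_mem := by
    rintro _ ⟨x, hx, rfl⟩ _ ⟨y, hy, rfl⟩ _ ⟨a, ha, rfl⟩ ⟨b, hb, hab⟩ ha1
    have haN : a ∉ N := fun h1 => ha1 ((QuotientGroup.eq_one_iff a).2 h1)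
    have hbN : b ∉ N := fun h1 => ha1 (hab ▸ (QuotientGroup.eq_one_iff b).2 h1)
    rw [← h.cent_eq hx ha haN, ← h.cent_eq hy hb hbN]
    exact h.map_cent_eq hN haN hab.symm
  conj := by
    rintro _ ⟨x, hx, rfl⟩ γ
    obtain ⟨n, rfl⟩ := QuotientGroup.mk_surjective γ
    refine ⟨_, ⟨n * x * n⁻¹, fun h1 => hx ?_, rfl⟩, ?_⟩
    · simpa [mul_assoc] using hNn.conj_mem' _ h1 n
    · rintro _ ⟨a, ha, rfl⟩
      exact ⟨n * a * n⁻¹, (conj_mem_cent n).2 ha, rfl⟩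
  card_eq := by
    rintro _ ⟨x, hx, rfl⟩
    have hmap : ∀ z ∉ N, Nat.card ((cent z).map (QuotientGroup.mk' N)) * Nat.card ↥(N ⊓ cent z) =
        c := fun z hz => by
      rw [← h.card_cent z hz, ← Subgroup.relIndex_ker, QuotientGroup.ker_mk',
        ← Subgroup.inf_relIndex_right, mul_comm]
      rw [← Subgroup.relIndex_bot_left, ← Subgroup.relIndex_bot_left]
      exact Subgroup.relIndex_mul_relIndex _ _ _ bot_le inf_le_right
    have hinf := Nat.dvd_antisymm (h.card_inf_cent_dvd hN hx hg) (h.card_inf_cent_dvd hN hg hx)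
    refine Nat.eq_of_mul_eq_mul_right (Nat.card_pos (α := ↥(N ⊓ cent g))) ?_
    rw [hmap g hg, ← hinf, hmap x hx]

theorem map_cent_eq_top (h : IsCentralizerFamily N c q r) (hN : HasPrimeSplittings N) {g : G}
    (hg : g ∉ N) : (cent g).map (QuotientGroup.mk' N) = ⊤ := by
  have hdvd : ∀ t : ℕ, t.Prime → (∃ u ∈ cent g, IsPElement t u ∧ u ∉ N) →
      t ∣ Nat.card ((cent g).map (QuotientGroup.mk' N)) := by
    rintro t ht ⟨u, hu, hut, huN⟩
    by_contra hd
    refine huN ((QuotientGroup.eq_one_iff u).1 ?_)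
    exact isPElement_of_not_dvd_eq_one ht hd ⟨u, hu, rfl⟩ (hut.map (QuotientGroup.mk' N))
  exact (h.isAbelianPartition hN hg).eq_top h.prime_left h.prime_right h.ne
    (hdvd q h.prime_left (h.exists_left g hg)) (hdvd r h.prime_right (h.exists_right g hg))
    ⟨g, hg, rfl⟩

theorem isCyclic_quotient (h : IsCentralizerFamily N c q r) (hN : HasPrimeSplittings N) {g : G}
    (hg : g ∉ N) (hgtop : cent g ≠ ⊤) :
    IsCyclic (G ⧸ N) ∧ (Nat.card (G ⧸ N)).Coprime (cent g).index := by
  have htop := h.map_cent_eq_top hN hg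
  have hsup : cent g ⊔ N = ⊤ := by
    rw [← QuotientGroup.ker_mk' N, ← Subgroup.comap_map_eq, htop, Subgroup.comap_top]
  refine ⟨?_, ?_⟩
  · by_contra hcyc
    have hcomm : ∀ α β : G ⧸ N, Commute α β := fun α β => by
      obtain ⟨a, ha, rfl⟩ := htop ▸ Subgroup.mem_top α
      obtain ⟨b, hb, rfl⟩ := htop ▸ Subgroup.mem_top β
      exact (h.commute g hg a ha b hb).map (QuotientGroup.mk' N)
    obtain ⟨t, ht, x', y', hx', hy', hy1, hxy⟩ := exists_prime_noncyclic_pair hcomm hcyc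
    obtain ⟨x, hx, hxt, rfl⟩ := exists_isPElement_mk_eq ht (isPElement_of_pow_prime_eq_one hx')
      (htop ▸ Subgroup.mem_top _)
    obtain ⟨y, hy, hyt, rfl⟩ := exists_isPElement_mk_eq ht (isPElement_of_pow_prime_eq_one hy')
      (htop ▸ Subgroup.mem_top _)
    rw [← QuotientGroup.mk_pow, QuotientGroup.eq_one_iff] at hx' hy'
    rw [Ne, QuotientGroup.eq_one_iff] at hy1
    obtain ⟨K, Y, hKY⟩ := hN t ht
    have := hKY.normal_left
    have hcy := h.cent_eq hg hy hy1
    have hY := right_le_cent_of_cent_mul_pow_eq ht hKY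
      (isNilpotent_of_le hN.isNilpotent hKY.right_le) (h.commute g hg x hx y hy)
      (hKY.mem_left ht hx' (hxt.pow t)) (hKY.mem_left ht hy' (hyt.pow t)) (fun i => by
        rw [hcy]
        refine h.cent_eq hg (mul_mem hx (pow_mem hy i)) fun h1 => hxy i ?_
        rw [← QuotientGroup.mk_pow, ← QuotientGroup.mk_mul, QuotientGroup.eq_one_iff]
        exact h1)
    have hK := h.le_cent ht hKY.isPGroup hyt hy1
    rw [hcy] at hY hK
    exact hgtop (by rw [← hsup, left_eq_sup, ← hKY.sup_eq]; exact sup_le hK hY)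
  · refine Nat.Coprime.symm (Nat.coprime_of_dvd fun t ht hti htq => ?_)
    have : Fact t.Prime := ⟨ht⟩
    obtain ⟨γ, hγ⟩ := exists_prime_orderOf_dvd_card' t htq
    obtain ⟨x, hx, hxt, rfl⟩ := exists_isPElement_mk_eq (C := cent g) ht
      (isPElement_of_pow_prime_eq_one (hγ ▸ pow_orderOf_eq_one γ)) (htop ▸ Subgroup.mem_top _)
    have hxN : x ∉ N := fun h1 => ht.one_lt.ne' (by
      rw [← hγ, (QuotientGroup.eq_one_iff x).2 h1, orderOf_one])
    obtain ⟨K, Y, hKY⟩ := hN t ht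
    have := hKY.normal_left
    have := hKY.normal_right
    have hK : K ≤ cent g := h.cent_eq hg hx hxN ▸ h.le_cent ht hKY.isPGroup hxt hxN
    refine not_dvd_index_of_sup_eq_top hKY.not_dvd ?_ hti
    rw [← hsup, ← hKY.sup_eq, ← sup_assoc, sup_eq_left.2 hK]

end IsCentralizerFamily

end CommutingPair

section ConstantClassSize

variable {G : Type*} [Group G] {N : Subgroup G} {s : ℕ}

theorem map_center_le_of_dvd_index {p : ℕ} (hs : ∀ g ∉ N, (cent g).index = s) (hps : p ∣ s)
    {P : Subgroup G} (hP : ¬ p ∣ P.index) : (Subgroup.center P).map P.subtype ≤ N := by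
  rintro _ ⟨z, hz, rfl⟩
  by_contra hzN
  have h1 : P ≤ cent (z : G) := fun x hx =>
    mem_cent.2 (congrArg Subtype.val (Subgroup.mem_center_iff.1 hz ⟨x, hx⟩))
  exact hP (hps.trans (hs _ hzN ▸ Subgroup.index_dvd_of_le h1))

variable [Finite G]

theorem isCyclic_quotient_or_prime_orderOf [N.Normal] (hN : HasPrimeSplittings N)
    (hs : ∀ g ∉ N, (cent g).index = s) (hs1 : s ≠ 1) :
    (IsCyclic (G ⧸ N) ∧ Nat.Coprime (Nat.card (G ⧸ N)) s) ∨
      ∀ x : G ⧸ N, x ≠ 1 → (orderOf x).Prime := by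
  by_cases hprime : ∀ x : G ⧸ N, x ≠ 1 → (orderOf x).Prime
  · exact Or.inr hprime
  left
  push Not at hprime
  obtain ⟨x, hx1, hx⟩ := hprime
  obtain ⟨g, rfl⟩ := QuotientGroup.mk_surjective x
  have hgN : g ∉ N := fun h => hx1 ((QuotientGroup.eq_one_iff g).2 h)
  have hcent : ∀ h ∉ N, Nat.card (cent h) = Nat.card (cent g) := fun h hh => by
    have h1 := (cent h).card_mul_index
    rw [hs h hh, ← (cent g).card_mul_index, hs g hgN] at h1
    refine Nat.eq_of_mul_eq_mul_right (Nat.pos_of_ne_zero ?_) h1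
    rw [← hs g hgN]
    exact Subgroup.index_ne_zero_of_finite
  have htop : ∀ h ∉ N, cent h ≠ ⊤ := fun h hh h1 => hs1 (by rw [← hs h hh, h1, Subgroup.index_top])
  by_cases hpair : ∀ q r : ℕ, q.Prime → r.Prime → q ≠ r → ∀ u v : G, IsPElement q u →
      IsPElement r v → u ∉ N → v ∉ N → ¬ Commute u v
  · have hr : (orderOf (g : G ⧸ N)).minFac.Prime :=
      Nat.minFac_prime fun h => hx1 (orderOf_eq_one_iff.1 h)
    have hrd := Nat.minFac_dvd (orderOf (g : G ⧸ N))
    set r := (orderOf (g : G ⧸ N)).minFac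
    obtain ⟨b, b', hb⟩ := exists_primePart_exponents G hr
    have hbN : g ^ b ∉ N := fun h => by
      have h1 : (g : G ⧸ N) = (g ^ b' : G) := by
        conv_lhs => rw [← (hb g).1]
        rw [QuotientGroup.mk_mul, (QuotientGroup.eq_one_iff _).2 h, one_mul]
      have h2 := Nat.Coprime.coprime_dvd_left
        (orderOf_map_dvd (QuotientGroup.mk' N) (g ^ b')) (hb g).2.2.1
      rw [QuotientGroup.mk'_apply, ← h1] at h2
      exact (Nat.Prime.coprime_iff_not_dvd hr).1 h2.symm hrd
    have hb'N : g ^ b' ∈ N := by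
      by_contra h
      obtain ⟨q, j, hq, hj, hjN⟩ := exists_isPElement_pow_notMem h
      refine hpair q r hq hr ?_ _ _ hj (hb g).2.1 hjN hbN ?_
      · rintro rfl
        apply hjN
        rw [hj.eq_one_of_coprime (Nat.Coprime.coprime_dvd_left (orderOf_pow_dvd j) (hb g).2.2.1)]
        exact N.one_mem
      · exact ((Commute.refl g).pow_pow b' b).pow_left j
    have hbr : (g ^ b) ^ r ∉ N := fun h => by
      have h1 : (g : G ⧸ N) = (g ^ b : G) := by
        conv_lhs => rw [← (hb g).1]
        rw [QuotientGroup.mk_mul, (QuotientGroup.eq_one_iff _).2 hb'N, mul_one]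
      have h2 : (g : G ⧸ N) ^ r = 1 := by
        rw [h1, ← QuotientGroup.mk_pow, (QuotientGroup.eq_one_iff _).2 h]
      exact hx (Nat.dvd_antisymm hrd (orderOf_dvd_of_pow_eq_one h2) ▸ hr)
    have h3 := isCyclic_quotient_of_pow_notMem hN hcent hpair hr (hb g).2.1 hbr (htop _ hbN)
    rwa [hs _ hbN] at h3
  · push Not at hpair
    obtain ⟨q, r, hq, hr, hqr, u, v, hu, hv, huN, hvN, huv⟩ := hpair
    have h1 := (isCentralizerFamily_of_commute hN hcent hq hr hqr hu hv huN hvN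
      huv).isCyclic_quotient hN huN (htop u huN)
    rwa [hs u huN] at h1

end ConstantClassSize

/-- Lemma 4.3: if `vcs(G) = {s}`, `p ∣ s`, `P ∈ Syl_p(G)`, and `X ⊴ G` with
`Z(Fit(G)) ≤ X ≤ Fit(G)` and every element of `G \ X` vanishing, then
`Z(P) ≤ Z(Fit(G))` (so `G/X` is a `p'`-group if `P` is abelian), and `G/X` is
cyclic of order coprime to `s` or all its nontrivial elements have prime
order. -/
theorem statement15 (G : Type) [Group G] [Finite G] (s : ℕ)
    (hvcs : vcs G = {s}) (p : ℕ) (hp : p.Prime) (hps : p ∣ s)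
    (P : Subgroup G) (hP : IsPGroup p ↥P) (hPsyl : ¬ p ∣ P.index)
    (X : Subgroup G) [hXn : X.Normal]
    (hZF : (Subgroup.center ↥(Fitting G)).map (Fitting G).subtype ≤ X)
    (hXF : X ≤ Fitting G)
    (hvan : ∀ g : G, g ∉ X → IsVanishing G g) :
    (Subgroup.center ↥P).map P.subtype
        ≤ (Subgroup.center ↥(Fitting G)).map (Fitting G).subtype ∧
    (IsAbelianSubgroup P → ¬ p ∣ Nat.card (G ⧸ X)) ∧
    ((IsCyclic (G ⧸ X) ∧ Nat.Coprime (Nat.card (G ⧸ X)) s) ∨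
      ∀ x : G ⧸ X, x ≠ 1 → (orderOf x).Prime) := by
  have hs : ∀ g ∉ X, (cent g).index = s := fun g hg => by
    have h1 : classSize g ∈ vcs G := ⟨g, hvan g hg, rfl⟩
    rwa [hvcs] at h1
  have hF : HasPrimeSplittings (Fitting G) := hasPrimeSplittings_iSup
  have hZX := map_center_le_of_dvd_index hs hps hPsyl
  refine ⟨sylow_center_le_fitting_center hp hF hP hPsyl (hZX.trans hXF), fun hab hd => ?_,
    isCyclic_quotient_or_prime_orderOf (hF.mono hXF) hs fun h1 => ?_⟩
  · refine hPsyl (hd.trans (Subgroup.index_dvd_of_le fun x hx => hZX ⟨⟨x, hx⟩, ?_, rfl⟩))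
    exact Subgroup.mem_center_iff.2 fun y => Subtype.ext (hab y y.2 x hx)
  · exact hp.one_lt.ne' (Nat.dvd_one.1 (h1 ▸ hps))
end
end
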